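/- Let K=K(c) be an A_n-crystal and 0<=a<=c. The upper subcrystal K^up[a] containing v[a], viewed as an (n-1)-colored graph with colors 1,...,n-1, is an A_{n-1}-crystal whose parameter c^up satisfies c^up_i=c_i-a_i+a_{i+1} for i=1,...,n-1; moreover v[a] belongs to the principal lattice of K^up[a] and its coordinate there is (a_2,a_3,...,a_n). Symmetrically, for 0<=b<=c, the lower subcrystal K^low[b] containing v[b], viewed with colors 2,...,n, is an A_{n-1}-crystal whose parameter c^low satisfies c^low_i=c_i-b_i+b_{i-1} for i=2,...,n, and v[b] belongs to the principal lattice of K^low[b] with coordinate (h_2,...,h_n) given by h_i=b_{i-1}. -/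

import Mathlib

open Classical

noncomputable section

/-- Iterate a partial operator `k` times. -/
def optIter {V : Type} (f : V → Option V) : ℕ → V → Option V
  | 0, v => some v
  | k + 1, v => (f v).bind (optIter f k)

/-- A vertex type together with, for every natural number (color) `i`,
a partial operator whose graph is the set of `i`-edges. -/
structure PreGraph where
  V : Type
  F : ℕ → V → Option V

namespace PreGraph

/-- Partial inverse operator of color `i`. -/
def Finv (K : PreGraph) (i : ℕ) (v : K.V) : Option K.V :=
  if h : ∃ u, K.F i u = some v then some h.choose else none

/-- Number of edges of the maximal `i`-colored path beginning at `v`. -/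
def h (K : PreGraph) (i : ℕ) (v : K.V) : ℕ :=
  sSup {k | (optIter (K.F i) k v).isSome = true}

/-- Number of edges of the maximal `i`-colored path ending at `v`. -/
def t (K : PreGraph) (i : ℕ) (v : K.V) : ℕ :=
  sSup {k | ∃ u, optIter (K.F i) k u = some v}

/-- One (undirected) step along an edge of any color. -/
def Step (K : PreGraph) (u v : K.V) : Prop :=
  ∃ i, K.F i u = some v ∨ K.F i v = some u

/-- Weak connectivity. -/
def Connected (K : PreGraph) : Prop :=
  ∀ u v : K.V, Relation.ReflTransGen K.Step u v

/-- All edges have colors in `C`. -/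
def ColorsIn (K : PreGraph) (C : Set ℕ) : Prop :=
  ∀ i ∉ C, ∀ v, K.F i v = none

end PreGraph

/-- `s` has no incoming edges. -/
def IsSource (K : PreGraph) (s : K.V) : Prop := ∀ i u, K.F i u ≠ some s

/-- `tv` has no outgoing edges. -/
def IsSink (K : PreGraph) (tv : K.V) : Prop := ∀ i, K.F i tv = none

/-- `K` is a (finite) colored graph with colors in `C` satisfying axiom (A1):
every connected monochromatic subgraph is a finite directed path. -/
def IsColored (K : PreGraph) (C : Set ℕ) : Prop :=
  Finite K.V ∧ K.ColorsIn C ∧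
  (∀ (i : ℕ) (u u' v : K.V), K.F i u = some v → K.F i u' = some v → u = u') ∧
  (∀ (i : ℕ) (v : K.V) (k : ℕ), 0 < k → optIter (K.F i) k v ≠ some v)

/-- `|i - j| = 1`. -/
def Neighb (i j : ℕ) : Prop := i + 1 = j ∨ j + 1 = i

/-- `|i - j| ≥ 2`. -/
def Far (i j : ℕ) : Prop := i + 2 ≤ j ∨ j + 2 ≤ i

instance (i j : ℕ) : Decidable (Neighb i j) := by unfold Neighb; infer_instance
instance (i j : ℕ) : Decidable (Far i j) := by unfold Far; infer_instance

/-- Axiom (A2) for the ordered pair of distinct colors `(i, j)`. -/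
def A2at (K : PreGraph) (i j : ℕ) : Prop :=
  (∀ u v, K.F i u = some v →
    K.t j v ≤ K.t j u ∧ K.h j u ≤ K.h j v ∧
    ((K.h j u : ℤ) - (K.t j u : ℤ)) - ((K.h j v : ℤ) - (K.t j v : ℤ)) =
      (if Neighb i j then (-1 : ℤ) else 0)) ∧
  (∀ u v w, K.F i u = some v → K.F i v = some w →
    2 * K.h j v ≤ K.h j u + K.h j w)

/-- Axiom (A3) for neighboring colors `i, j`. -/
def A3at (K : PreGraph) (i j : ℕ) : Prop :=
  (∀ u v v', K.F i u = some v → K.F j u = some v' →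
    K.h j v = K.h j u →
    ((K.h i v' : ℤ) - (K.h i u : ℤ) = 1 ∧ ∃ w, K.F j v = some w ∧ K.F i v' = some w)) ∧
  (∀ u u' v, K.F i u = some v → K.F j u' = some v →
    (K.h j v : ℤ) - (K.h j u : ℤ) = 1 →
    (K.h i v = K.h i u' ∧ ∃ w, K.F j w = some u ∧ K.F i w = some u'))

/-- Axiom (A4) (Verma relations) for neighboring colors `i, j`. -/
def A4at (K : PreGraph) (i j : ℕ) : Prop :=
  (∀ u v v', K.F i u = some v → K.F j u = some v' →
    (K.h j v : ℤ) - (K.h j u : ℤ) = 1 → (K.h i v' : ℤ) - (K.h i u : ℤ) = 1 →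
    ∃ w, (((K.F i u).bind (K.F j)).bind (K.F j)).bind (K.F i) = some w ∧
         (((K.F j u).bind (K.F i)).bind (K.F i)).bind (K.F j) = some w) ∧
  (∀ u u' v, K.F i u = some v → K.F j u' = some v →
    K.h j v = K.h j u → K.h i v = K.h i u' →
    ∃ w, (((K.Finv i v).bind (K.Finv j)).bind (K.Finv j)).bind (K.Finv i) = some w ∧
         (((K.Finv j v).bind (K.Finv i)).bind (K.Finv i)).bind (K.Finv j) = some w)

/-- Axiom (A5) for colors `i, j` at distance at least 2. -/
def A5at (K : PreGraph) (i j : ℕ) : Prop :=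
  ∀ Fi ∈ ({K.F i, K.Finv i} : Set (K.V → Option K.V)),
  ∀ Fj ∈ ({K.F j, K.Finv j} : Set (K.V → Option K.V)),
  ∀ v, (Fi v).isSome → (Fj v).isSome →
    ∃ w, (Fi v).bind Fj = some w ∧ (Fj v).bind Fi = some w

/-- `K` is a regular crystal of type A on the color set `C`
(an `A_{|C|}`-crystal when `C` is an integer interval). -/
def IsCrystalOn (K : PreGraph) (C : Set ℕ) : Prop :=
  IsColored K C ∧ K.Connected ∧
  (∀ i ∈ C, ∀ j ∈ C, i ≠ j → A2at K i j) ∧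
  (∀ i ∈ C, ∀ j ∈ C, Neighb i j → A3at K i j ∧ A4at K i j) ∧
  (∀ i ∈ C, ∀ j ∈ C, Far i j → A5at K i j)

/-- `K` is an `A_n`-crystal (colors `1, …, n`). -/
def IsACrystal (n : ℕ) (K : PreGraph) : Prop := IsCrystalOn K (Set.Icc 1 n)

/-- Apply a list of operators, head first. -/
def applyStr (K : PreGraph) : List ℕ → K.V → Option K.V
  | [], v => some v
  | i :: L, v => (K.F i v).bind (applyStr K L)

/-- The string `w_{m,k,j} = F_{o+j} F_{o+j+1} ⋯ F_{o+j+k-1}` (rightmost applied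
first, i.e. head of the list applied first) for a crystal with colors `o+1, …, o+m`. -/
def wStr (o k j : ℕ) : List ℕ := (List.range k).map (fun m => o + j + k - 1 - m)

/-- The string `S_{m,k} = w_{m,k,m-k+1} ⋯ w_{m,k,2} w_{m,k,1}` for a crystal with
colors `o+1, …, o+m`. -/
def SStr (o m k : ℕ) : List ℕ :=
  (List.range (m - k + 1)).flatMap fun jm => wStr o k (jm + 1)

/-- The string `S_{m,m}^{a_{o+m}} ⋯ S_{m,1}^{a_{o+1}}` for a crystal with colors
`o+1, …, o+m`, defining the principal vertex with coordinates `a`. -/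
def prinStr (o m : ℕ) (a : ℕ → ℕ) : List ℕ :=
  (List.range m).flatMap fun km => (List.replicate (a (o + km + 1)) (SStr o m (km + 1))).flatten

def prinOpt (K : PreGraph) (o m : ℕ) (s : K.V) (a : ℕ → ℕ) : Option K.V :=
  applyStr K (prinStr o m a) s

/-- `p` is the principal vertex with coordinates `a` of the crystal `K` with colors
`o+1, …, o+m` and source `s`. -/
def IsPrin (K : PreGraph) (o m : ℕ) (s : K.V) (a : ℕ → ℕ) (p : K.V) : Prop :=
  prinOpt K o m s a = some p

/-- The principal lattice of an `A_n`-crystal with source `s` and parameter `c`. -/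
def PrinLat (K : PreGraph) (n : ℕ) (s : K.V) (c : ℕ → ℕ) : Set K.V :=
  {p | ∃ a : ℕ → ℕ, (∀ i, 1 ≤ i → i ≤ n → a i ≤ c i) ∧ IsPrin K 0 n s a p}

/-- One undirected step along an edge with color in `I`. -/
def stepOn (K : PreGraph) (I : Set ℕ) (u v : K.V) : Prop :=
  ∃ i ∈ I, K.F i u = some v ∨ K.F i v = some u

/-- `u` lies in the same `I`-colored component as `v`. -/
def inComp (K : PreGraph) (I : Set ℕ) (v u : K.V) : Prop :=
  Relation.ReflTransGen (stepOn K I) v u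

/-- The subcrystal of `K` with color set `I` containing `v` (the maximal connected
subgraph through `v` using only colors in `I`). -/
def PreGraph.sub (K : PreGraph) (I : Set ℕ) (v : K.V) : PreGraph where
  V := {u : K.V // inComp K I v u}
  F := fun i u =>
    if hi : i ∈ I then
      (K.F i u.1).pbind fun w hw =>
        some ⟨w, Relation.ReflTransGen.tail u.2 ⟨i, hi, Or.inl (Option.mem_def.mp hw)⟩⟩
    else none

/-- Directed reachability. -/
def dirReach (K : PreGraph) (u v : K.V) : Prop :=
  Relation.ReflTransGen (fun a b => ∃ i, K.F i a = some b) u v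

/-- The interval of `K` from `p` to `q`: the subgraph formed by all vertices and
edges lying on directed paths from `p` to `q`. -/
def PreGraph.interval (K : PreGraph) (p q : K.V) : PreGraph where
  V := {w : K.V // dirReach K p w ∧ dirReach K w q}
  F := fun i u =>
    (K.F i u.1).pbind fun w _ =>
      if hw : dirReach K p w ∧ dirReach K w q then some ⟨w, hw⟩ else none

/-- The symmetric extract: restriction to self-complementary vertices,
with `ibar`-edges given by `chain i`. -/
def extract (K : PreGraph) (chain : ℕ → K.V → Option K.V) (σ : K.V → K.V) : PreGraph where
  V := {v : K.V // σ v = v}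
  F := fun i u =>
    (chain i u.1).pbind fun w _ => if hw : σ w = w then some ⟨w, hw⟩ else none

/-- The operator chain for the color `ibar` of the symmetric extract of a
symmetric `A_{2n-1}`-crystal. -/
def chainB (K : PreGraph) (n : ℕ) (i : ℕ) (u : K.V) : Option K.V :=
  if 1 ≤ i ∧ i ≤ n then
    (if i = n then K.F n u else (K.F i u).bind (K.F (2 * n - i)))
  else none

/-- The operator chain for the color `ibar` of the symmetric extract of a
symmetric `A_{2n}`-crystal. -/
def chainC (K : PreGraph) (n : ℕ) (i : ℕ) (u : K.V) : Option K.V :=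
  if 1 ≤ i ∧ i ≤ n then
    (if i = n then (((K.F n u).bind (K.F (n + 1))).bind (K.F (n + 1))).bind (K.F n)
     else (K.F i u).bind (K.F (2 * n + 1 - i)))
  else none

/-- Symmetric extract from a symmetric `A_{2n-1}`-crystal. -/
def extractB (K : PreGraph) (n : ℕ) (σ : K.V → K.V) : PreGraph := extract K (chainB K n) σ

/-- Symmetric extract from a symmetric `A_{2n}`-crystal. -/
def extractC (K : PreGraph) (n : ℕ) (σ : K.V → K.V) : PreGraph := extract K (chainC K n) σ

/-- Admissibility of a six-tuple `(x', y, x''; y', x, y'')` in the worm model. -/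
def WormOK (g1 g2 : ℕ) : ℤ × ℤ × ℤ × ℤ × ℤ × ℤ → Prop
  | (x', y, x'', y', x, y'') =>
    (0 ≤ x' ∧ x' ≤ 2 * (g1 : ℤ)) ∧ (0 ≤ x'' ∧ x'' ≤ 2 * (g1 : ℤ)) ∧
    (0 ≤ x ∧ x ≤ 2 * (g1 : ℤ)) ∧
    (0 ≤ y' ∧ y' ≤ (g2 : ℤ)) ∧ (0 ≤ y'' ∧ y'' ≤ (g2 : ℤ)) ∧ (0 ≤ y ∧ y ≤ (g2 : ℤ)) ∧
    (2 ∣ x') ∧ (2 ∣ x'') ∧ (y' ≤ y ∧ y ≤ y'') ∧ (x' ≤ x ∧ x ≤ x'') ∧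
    (y' < y → x' = x) ∧ (y < y'' → x = x'')

/-- The candidate image of a worm under the operator `1tilde`. -/
def worm1 : ℤ × ℤ × ℤ × ℤ × ℤ × ℤ → ℤ × ℤ × ℤ × ℤ × ℤ × ℤ
  | (x', y, x'', y', x, y'') =>
    if 2 * x > x' + x'' then (x' + 2, y, x'', y', x, y'')
    else if x = x' ∧ x' = x'' ∧ y < y'' then (x', y + 1, x'', y', x, y'')
    else (x', y, x'' + 2, y', x, y'')

/-- The candidate image of a worm under the operator `2tilde`. -/
def worm2 : ℤ × ℤ × ℤ × ℤ × ℤ × ℤ → ℤ × ℤ × ℤ × ℤ × ℤ × ℤ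
  | (x', y, x'', y', x, y'') =>
    if 2 * y > y' + y'' then (x', y, x'', y' + 1, x, y'')
    else if y' = y ∧ y = y'' ∧ x < x'' then (x', y, x'', y', x + 1, y'')
    else (x', y, x'', y', x, y'' + 1)

/-- The worm graph `W(g1, g2)`, with colors `1 = 1tilde` and `2 = 2tilde`. -/
def WormGraph (g1 g2 : ℕ) : PreGraph where
  V := {w : ℤ × ℤ × ℤ × ℤ × ℤ × ℤ // WormOK g1 g2 w}
  F := fun i u =>
    if i = 1 then
      (if h1 : WormOK g1 g2 (worm1 u.1) then some ⟨worm1 u.1, h1⟩ else none)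
    else if i = 2 then
      (if h2 : WormOK g1 g2 (worm2 u.1) then some ⟨worm2 u.1, h2⟩ else none)
    else none

/-- Isomorphism of colored graphs, renaming colors via `φ`. -/
def IsoVia (K L : PreGraph) (φ : ℕ → ℕ) : Prop :=
  ∃ e : K.V ≃ L.V, ∀ i u v, K.F i u = some v ↔ L.F (φ i) (e u) = some (e v)

/-- The Cartesian product of an `i`-path of length `p` and a `j`-path of length `q`. -/
def boxGraph (i j p q : ℕ) : PreGraph where
  V := Fin (p + 1) × Fin (q + 1)
  F := fun s u =>
    if s = i then
      (if h : (u.1 : ℕ) < p then some (⟨(u.1 : ℕ) + 1, by omega⟩, u.2) else none)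
    else if s = j then
      (if h : (u.2 : ℕ) < q then some (u.1, ⟨(u.2 : ℕ) + 1, by omega⟩) else none)
    else none

/-- `B_n`-crystal: components with colors `n-1, n` are worm graphs,
with color `n-1` corresponding to `1tilde` and `n` to `2tilde`. -/
def IsBCrystal (n : ℕ) (B : PreGraph) : Prop :=
  IsColored B (Set.Icc 1 n) ∧ B.Connected ∧
  (∀ i ∈ Set.Icc 1 n, ∀ j ∈ Set.Icc 1 n, Far i j → A5at B i j) ∧
  (∀ i j, 1 ≤ i → i < n → 1 ≤ j → j < n → Neighb i j →
    ∀ v : B.V, IsCrystalOn (B.sub {i, j} v) {i, j}) ∧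
  (∀ v : B.V, ∃ g1 g2 : ℕ,
    IsoVia (B.sub ({n - 1, n} : Set ℕ) v) (WormGraph g1 g2)
      (fun x => if x = n - 1 then 1 else if x = n then 2 else 0))

/-- `C_n`-crystal: components with colors `n-1, n` are worm graphs,
with color `n-1` corresponding to `2tilde` and `n` to `1tilde`. -/
def IsCCrystal (n : ℕ) (B : PreGraph) : Prop :=
  IsColored B (Set.Icc 1 n) ∧ B.Connected ∧
  (∀ i ∈ Set.Icc 1 n, ∀ j ∈ Set.Icc 1 n, Far i j → A5at B i j) ∧
  (∀ i j, 1 ≤ i → i < n → 1 ≤ j → j < n → Neighb i j →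
    ∀ v : B.V, IsCrystalOn (B.sub {i, j} v) {i, j}) ∧
  (∀ v : B.V, ∃ g1 g2 : ℕ,
    IsoVia (B.sub ({n - 1, n} : Set ℕ) v) (WormGraph g1 g2)
      (fun x => if x = n - 1 then 2 else if x = n then 1 else 0))

/-! ### The crossing model -/

/-- `(k, i, j)` is a node `v_i^k(j)` of the supporting graph `G` for rank `n`. -/
def isNode (n k i j : ℕ) : Prop :=
  1 ≤ j ∧ j ≤ i ∧ i ≤ n ∧ i - j + 1 ≤ k ∧ k ≤ n - j + 1

instance (n k i j : ℕ) : Decidable (isNode n k i j) := by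
  unfold isNode; infer_instance

/-- Extension of a function on the nodes of `G` to the extended supporting graph:
extra nodes from which `G^k` is reachable get value `c k`, the others get `0`. -/
def fext (n : ℕ) (c : ℕ → ℕ) (f : ℕ × ℕ × ℕ → ℤ) (k i j : ℕ) : ℤ :=
  if isNode n k i j then f (k, i, j)
  else if j ≤ n - k + 1 then (c k : ℤ) else 0

/-- The slack at the node `v_i^k(j)`. -/
def epsN (n : ℕ) (c : ℕ → ℕ) (f : ℕ × ℕ × ℕ → ℤ) (k i j : ℕ) : ℤ :=
  (fext n c f k (i - 1) (j - 1) - fext n c f k i j) -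
    (fext n c f k i (j - 1) - fext n c f k (i + 1) j)

/-- The total slack at the multinode `V_i(j)`. -/
def epsTot (n : ℕ) (c : ℕ → ℕ) (f : ℕ × ℕ × ℕ → ℤ) (i j : ℕ) : ℤ :=
  ∑ k ∈ Finset.Icc (i - j + 1) (n - j + 1), epsN n c f k i j

/-- The reduced slack at the multinode `V_i(j)`. -/
def teps (n : ℕ) (c : ℕ → ℕ) (f : ℕ × ℕ × ℕ → ℤ) (i j : ℕ) : ℤ :=
  if hj : (Finset.Icc 1 j).Nonempty then
    max 0 ((Finset.Icc 1 j).inf' hj fun p => ∑ q ∈ Finset.Icc p j, epsTot n c f i q)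
  else 0

/-- `k0` satisfies the switch condition in the multinode `V_i(j)`. -/
def switchCond (n : ℕ) (f : ℕ × ℕ × ℕ → ℤ) (i j k0 : ℕ) : Prop :=
  i - j + 1 ≤ k0 ∧ k0 ≤ n - j + 1 ∧
  (∀ k, i - j + 1 ≤ k → k < k0 → isNode n k (i + 1) (j + 1) →
    f (k, i, j) = f (k, i + 1, j + 1)) ∧
  (∀ k, k0 < k → k ≤ n - j + 1 → isNode n k (i + 1) j →
    f (k, i + 1, j) = f (k, i, j))

/-- The switch-node (first node with the switch property) of the multinode `V_i(j)`. -/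
def switchNode (n : ℕ) (f : ℕ × ℕ × ℕ → ℤ) (i j : ℕ) : ℕ :=
  sInf {k0 | switchCond n f i j k0}

/-- Feasible functions of the crossing model (normalized to vanish off the nodes). -/
def Feasible (n : ℕ) (c : ℕ → ℕ) (f : ℕ × ℕ × ℕ → ℤ) : Prop :=
  (∀ k i j, ¬ isNode n k i j → f (k, i, j) = 0) ∧
  (∀ k i j, isNode n k i j → isNode n k (i - 1) j → f (k, i - 1, j) ≤ f (k, i, j)) ∧
  (∀ k i j, isNode n k i j → isNode n k (i + 1) (j + 1) → f (k, i + 1, j + 1) ≤ f (k, i, j)) ∧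
  (∀ k i j, isNode n k i j → 0 ≤ f (k, i, j) ∧ f (k, i, j) ≤ (c k : ℤ)) ∧
  (∀ i j, 1 ≤ j → j ≤ i → i ≤ n → ∃ k0, switchCond n f i j k0)

/-- Increase `f` by one at the node `(k, i, j)`. -/
def bump (f : ℕ × ℕ × ℕ → ℤ) (k i j : ℕ) : ℕ × ℕ × ℕ → ℤ :=
  fun x => if x = (k, i, j) then f x + 1 else f x

/-- The crossing-model graph `Kscr(c)`: vertices are the feasible functions, and
the move `φ_i` increases `f` by one at the switch-node of the active multinode. -/
def Kscr (n : ℕ) (c : ℕ → ℕ) : PreGraph where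
  V := {f : ℕ × ℕ × ℕ → ℤ // Feasible n c f}
  F := fun i f =>
    if 1 ≤ i ∧ i ≤ n ∧ ∃ j, 1 ≤ j ∧ j ≤ i ∧ 0 < teps n c f.1 i j then
      (let j := sSup {j | 1 ≤ j ∧ j ≤ i ∧ 0 < teps n c f.1 i j}
       let g := bump f.1 (switchNode n f.1 i j) i j
       if hg : Feasible n c g then some ⟨g, hg⟩ else none)
    else none

/-- The function `f_{a,D}` of the crossing model. -/
def faD (n : ℕ) (a : ℕ → ℕ) (D : ℕ → ℤ) : ℕ × ℕ × ℕ → ℤ := fun x =>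
  if isNode n x.1 x.2.1 x.2.2 then
    (if x.2.1 - x.2.2 + 1 = x.1 then (a x.1 : ℤ) else (a x.1 : ℤ) + min (D (x.1 - 1)) 0) +
    (if x.2.2 ≤ n - x.1 then max (D x.1) 0 else 0)
  else 0

/-! ### Descriptions of self-complementary vertices -/

/-- `(a1, a2, δ, l)` is the description of a self-complementary vertex `v` of a
symmetric `A_3`-crystal `K` with source `s` and parameter `c`. -/
def IsDescB (K : PreGraph) (s : K.V) (c : ℕ → ℕ) (v : K.V) (q : ℕ × ℕ × ℤ × ℕ) : Prop :=
  q.2.2.2 = K.t 2 v ∧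
  ∃ (a : ℕ → ℕ) (pa : K.V),
    a 1 = q.1 ∧ a 2 = q.2.1 ∧ a 3 = ((q.1 : ℤ) + max q.2.2.1 0).toNat ∧
    (∀ i, 1 ≤ i → i ≤ 3 → a i ≤ c i) ∧
    IsPrin K 0 3 s a pa ∧ inComp K (Set.Icc 1 2) pa v ∧
    0 ≤ (q.2.1 : ℤ) + q.2.2.1 ∧ 0 ≤ (a 3 : ℤ) - q.2.2.1 ∧
    ∃ s' : (K.sub (Set.Icc 1 2) pa).V, IsSource (K.sub (Set.Icc 1 2) pa) s' ∧
    ∃ z : (K.sub (Set.Icc 1 2) pa).V,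
      IsPrin (K.sub (Set.Icc 1 2) pa) 0 2 s'
        (fun i => if i = 1 then ((q.2.1 : ℤ) + q.2.2.1).toNat else ((a 3 : ℤ) - q.2.2.1).toNat) z ∧
      inComp K ({2} : Set ℕ) z.1 v

/-- The polytope of descriptions for a symmetric `A_3`-crystal with parameter `(c1, c2, c1)`. -/
def QuadB (c1 c2 : ℕ) : Set (ℕ × ℕ × ℤ × ℕ) :=
  {q | q.1 ≤ c1 ∧ q.2.1 ≤ c2 ∧ -(q.2.1 : ℤ) ≤ q.2.2.1 ∧ (q.2.1 : ℤ) - (c2 : ℤ) ≤ q.2.2.1 ∧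
       q.2.2.1 ≤ (c1 : ℤ) - (q.1 : ℤ) ∧ (q.2.2.2 : ℤ) ≤ (c2 : ℤ) + 2 * q.2.2.1}

/-- The worm associated to the description `(a1, a2, δ, l)`. -/
def wtupleB (a1 a2 : ℕ) (δ : ℤ) (l : ℕ) : ℤ × ℤ × ℤ × ℤ × ℤ × ℤ :=
  let a3 : ℤ := (a1 : ℤ) + max δ 0
  let tr : ℤ × ℤ × ℤ :=
    if 0 ≤ δ then
      if (l : ℤ) ≤ (a2 : ℤ) then ((l : ℤ), 2 * (a1 : ℤ), (a2 : ℤ))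
      else if (l : ℤ) ≤ (a2 : ℤ) + 2 * δ then
        ((a2 : ℤ), 2 * (a1 : ℤ) + (l : ℤ) - (a2 : ℤ), (a2 : ℤ))
      else ((a2 : ℤ), 2 * a3, (l : ℤ) - 2 * δ)
    else
      if (l : ℤ) ≤ (a2 : ℤ) + δ then ((l : ℤ), 2 * (a1 : ℤ), (a2 : ℤ) - δ)
      else ((a2 : ℤ) + δ, 2 * (a1 : ℤ), (l : ℤ) - 2 * δ)
  (2 * (a1 : ℤ), (a2 : ℤ), 2 * a3, tr.1, tr.2.1, tr.2.2)

def wtQ (q : ℕ × ℕ × ℤ × ℕ) : ℤ × ℤ × ℤ × ℤ × ℤ × ℤ :=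
  wtupleB q.1 q.2.1 q.2.2.1 q.2.2.2

/-- The string `(F_2 F_3)^r (F_3 F_2)^r` (rightmost applied first). -/
def diagStr (r : ℕ) : List ℕ :=
  (List.replicate r ([2, 3] : List ℕ)).flatten ++ (List.replicate r ([3, 2] : List ℕ)).flatten

/-- `(a1, a2, δ, ρ)` is the description of a self-complementary vertex `v` of a
symmetric `A_4`-crystal `K` with source `s` and parameter `c`. -/
def IsDescC (K : PreGraph) (s : K.V) (c : ℕ → ℕ) (v : K.V) (q : ℕ × ℕ × ℤ × ℕ) : Prop :=
  ∃ (a : ℕ → ℕ) (pa : K.V),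
    a 1 = q.1 ∧ a 2 = q.2.1 ∧ a 3 = ((q.2.1 : ℤ) + min q.2.2.1 0).toNat ∧
    a 4 = ((q.1 : ℤ) + max q.2.2.1 0).toNat ∧
    (∀ i, 1 ≤ i → i ≤ 4 → a i ≤ c i) ∧
    IsPrin K 0 4 s a pa ∧ inComp K (Set.Icc 1 3) pa v ∧
    0 ≤ (q.2.1 : ℤ) + q.2.2.1 ∧ 0 ≤ (a 4 : ℤ) - q.2.2.1 ∧
    (∃ s' : (K.sub (Set.Icc 1 3) pa).V, IsSource (K.sub (Set.Icc 1 3) pa) s' ∧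
     ∃ z : (K.sub (Set.Icc 1 3) pa).V,
       IsPrin (K.sub (Set.Icc 1 3) pa) 0 3 s'
         (fun i => if i = 1 then ((q.2.1 : ℤ) + q.2.2.1).toNat
                   else if i = 2 then a 3 else ((a 4 : ℤ) - q.2.2.1).toNat) z ∧
       inComp K (Set.Icc 2 3) z.1 v) ∧
    (∃ stil : (K.sub (Set.Icc 2 3) v).V, IsSource (K.sub (Set.Icc 2 3) v) stil ∧
       applyStr (K.sub (Set.Icc 2 3) v) (diagStr q.2.2.2) stil =
         some ⟨v, Relation.ReflTransGen.refl⟩)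

/-- The polytope of descriptions for a symmetric `A_4`-crystal with parameter
`(c1, c2, c2, c1)`. -/
def QuadC (c1 c2 : ℕ) : Set (ℕ × ℕ × ℤ × ℕ) :=
  {q | q.1 ≤ c1 ∧ q.2.1 ≤ c2 ∧ -(q.2.1 : ℤ) ≤ q.2.2.1 ∧
       q.2.2.1 ≤ (c1 : ℤ) - (q.1 : ℤ) ∧ (q.2.2.2 : ℤ) ≤ (c2 : ℤ) + q.2.2.1}

end

/-- A colored graph together with inverse operators and string-length statistics. -/
structure ECrystal extends PreGraph where
  E : ℕ → V → Option V
  ep : ℕ → V → ℕ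
  ph : ℕ → V → ℕ

namespace ECrystal

/-- The crystal with all edges reversed. -/
def dual (X : ECrystal) : ECrystal where
  V := X.V
  F := X.E
  E := X.F
  ep := X.ph
  ph := X.ep

/-- The part of the local axioms of a regular crystal on the colors `C` that
speaks about outgoing edges. -/
structure Forward (X : ECrystal) (C : Set ℕ) : Prop where
  inv : ∀ i ∈ C, ∀ u v, X.F i u = some v ↔ X.E i v = some u
  pos : ∀ i ∈ C, ∀ u, 0 < X.ph i u ↔ ∃ v, X.F i u = some v
  step : ∀ i ∈ C, ∀ u v, X.F i u = some v →
    X.ph i u = X.ph i v + 1 ∧ X.ep i v = X.ep i u + 1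
  near : ∀ i ∈ C, ∀ j ∈ C, Neighb i j → ∀ u v, X.F i u = some v →
    (X.ph j v = X.ph j u ∧ X.ep j u = X.ep j v + 1) ∨
    (X.ph j v = X.ph j u + 1 ∧ X.ep j v = X.ep j u)
  far : ∀ i ∈ C, ∀ j ∈ C, Far i j → ∀ u v, X.F i u = some v →
    X.ph j v = X.ph j u ∧ X.ep j v = X.ep j u
  far_comm : ∀ i ∈ C, ∀ j ∈ C, Far i j → ∀ u v v', X.F i u = some v → X.F j u = some v' →
    ∃ w, X.F j v = some w ∧ X.F i v' = some w
  near_comm : ∀ i ∈ C, ∀ j ∈ C, Neighb i j → ∀ u v v', X.F i u = some v → X.F j u = some v' →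
    X.ph j v = X.ph j u → X.ph i v' = X.ph i u + 1 ∧ ∃ w, X.F j v = some w ∧ X.F i v' = some w
  verma : ∀ i ∈ C, ∀ j ∈ C, Neighb i j → ∀ u v v', X.F i u = some v → X.F j u = some v' →
    X.ph j v = X.ph j u + 1 → X.ph i v' = X.ph i u + 1 →
    ∃ p q p' q' w, X.F j v = some p ∧ X.F j p = some q ∧ X.F i q = some w ∧
      X.F i v' = some p' ∧ X.F i p' = some q' ∧ X.F j q' = some w

/-- The local axioms of a regular crystal of type A on the colors `C`. -/
def Regular (X : ECrystal) (C : Set ℕ) : Prop := X.Forward C ∧ X.dual.Forward C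

theorem Regular.dual {X : ECrystal} {C : Set ℕ} (hX : X.Regular C) : X.dual.Regular C :=
  ⟨hX.2, hX.1⟩

variable {X Y : ECrystal} {C : Set ℕ}

theorem Regular.label_after_raise (hX : X.Regular C) {i j : ℕ} (hi : i ∈ C) (hj : j ∈ C)
    (hij : Neighb i j) {x y z : X.V} (hxy : X.F i x = some y) (hyz : X.F j y = some z)
    (hl : X.ph j y = X.ph j x + 1) : X.ph i z = X.ph i y := by
  obtain ⟨hF, hE⟩ := hX
  have h1 := hF.near j hj i hi hij.symm y z hyz
  have h2 := hF.step i hi x y hxy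
  have h3 := hF.near i hi j hj hij x y hxy
  by_contra hne
  have h4 : X.ep i z = X.ep i y := by omega
  obtain ⟨w, hw⟩ := (hE.pos i hi z).1 (show 0 < X.ep i z by omega)
  have hzy : X.E j z = some y := (hF.inv j hj y z).1 hyz
  have hyx : X.E i y = some x := (hF.inv i hi x y).1 hxy
  obtain ⟨h5, v, hv, hv'⟩ := hE.near_comm j hj i hi hij.symm z y w hzy hw h4.symm
  change X.E i y = some v at hv
  change X.E j w = some v at hv'
  obtain rfl : x = v := by rw [hyx] at hv; exact Option.some.inj hv
  have h6 := hF.step j hj x w ((hF.inv j hj x w).2 hv')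
  have h7 := hF.step j hj y z hyz
  change X.ep j w = X.ep j z + 1 at h5
  omega

theorem Regular.label_after_square (hX : X.Regular C) {i j : ℕ} (hi : i ∈ C) (hj : j ∈ C)
    (hij : Neighb i j) {q q₁ q₂ r r' : X.V} (h1 : X.F i q = some q₁) (h2 : X.F j q = some q₂)
    (hl : X.ph j q₁ = X.ph j q) (h3 : X.F i q₂ = some r) (h4 : X.F i r = some r') :
    X.ph j r' = X.ph j r := by
  obtain ⟨hF, hE⟩ := hX
  obtain ⟨hl', w, hw, hw'⟩ := hF.near_comm i hi j hj hij q q₁ q₂ h1 h2 hl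
  obtain rfl : r = w := by rw [h3] at hw'; exact Option.some.inj hw'
  have e1 := hF.step i hi _ _ h1
  have e2 := hF.step j hj _ _ h2
  have e3 := hF.step i hi _ _ h3
  have e4 := hF.step i hi _ _ h4
  have e5 := hF.step j hj _ _ hw
  have n1 := hF.near i hi j hj hij _ _ h1
  have n2 := hF.near j hj i hi hij.symm _ _ h2
  have n4 := hF.near i hi j hj hij _ _ h4
  by_contra hne
  obtain ⟨y, hy⟩ := (hE.pos j hj r').1 (show 0 < X.ep j r' by omega)
  have hr : X.E i r' = some r := (hF.inv i hi _ _).1 h4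
  obtain ⟨h5, v, hv, hv'⟩ := hE.near_comm i hi j hj hij r' r y hr hy
    (show X.ep j r = X.ep j r' by omega)
  change X.E j r = some v at hv
  change X.E i y = some v at hv'
  change X.ep i y = X.ep i r' + 1 at h5
  obtain rfl : q₁ = v := by
    rw [(hF.inv j hj _ _).1 hw] at hv; exact Option.some.inj hv
  have e6 := hF.step i hi _ _ ((hF.inv i hi _ _).2 hv')
  omega

/-- At the top of a Verma configuration whose bottom edges have label `0`, the edges have
label `1`. -/
theorem Regular.verma_top (hX : X.Regular C) {i j : ℕ} (hi : i ∈ C) (hj : j ∈ C)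
    (hij : Neighb i j) {z a b d a' b' d' x : X.V}
    (h1 : X.F i z = some a) (h2 : X.F j a = some b) (h3 : X.F j b = some d)
    (h4 : X.F i d = some x)
    (h1' : X.F j z = some a') (h2' : X.F i a' = some b') (h3' : X.F i b' = some d')
    (h4' : X.F j d' = some x)
    (hd : X.ep j d = X.ep j x + 1) (hd' : X.ep i d' = X.ep i x + 1) :
    X.ph j a = X.ph j z + 1 := by
  obtain ⟨hF, hE⟩ := hX
  have s1 := hF.step i hi _ _ h1
  have s2 := hF.step j hj _ _ h2
  have s3 := hF.step j hj _ _ h3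
  have s4 := hF.step i hi _ _ h4
  have s1' := hF.step j hj _ _ h1'
  have s2' := hF.step i hi _ _ h2'
  have s3' := hF.step i hi _ _ h3'
  have s4' := hF.step j hj _ _ h4'
  have n1 := hF.near i hi j hj hij _ _ h1
  have n2 := hF.near j hj i hi hij.symm _ _ h2
  have n3 := hF.near j hj i hi hij.symm _ _ h3
  have n4 := hF.near i hi j hj hij _ _ h4
  have n1' := hF.near j hj i hi hij.symm _ _ h1'
  have n2' := hF.near i hi j hj hij _ _ h2'
  have n3' := hF.near i hi j hj hij _ _ h3'
  have n4' := hF.near j hj i hi hij.symm _ _ h4'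
  by_contra hne
  obtain ⟨hl, w, hw, hw'⟩ := hF.near_comm i hi j hj hij z a a' h1 h1' (by omega)
  obtain rfl : b = w := by rw [h2] at hw; exact Option.some.inj hw
  obtain rfl : b = b' := by rw [h2'] at hw'; exact (Option.some.inj hw').symm
  have := (hF.near_comm i hi j hj hij b d' d h3' h3 (by omega)).1
  omega

/-- The tensor product of two crystals. -/
def tensor (X Y : ECrystal) : ECrystal where
  V := X.V × Y.V
  F i u := if Y.ep i u.2 < X.ph i u.1 then (X.F i u.1).map (fun p => (p, u.2))
    else (Y.F i u.2).map (fun q => (u.1, q))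
  E i u := if Y.ep i u.2 ≤ X.ph i u.1 then (X.E i u.1).map (fun p => (p, u.2))
    else (Y.E i u.2).map (fun q => (u.1, q))
  ep i u := X.ep i u.1 + (Y.ep i u.2 - X.ph i u.1)
  ph i u := Y.ph i u.2 + (X.ph i u.1 - Y.ep i u.2)

theorem tensor_F_iff {i : ℕ} {p p' : X.V} {q q' : Y.V} :
    (tensor X Y).F i (p, q) = some (p', q') ↔
      (Y.ep i q < X.ph i p ∧ X.F i p = some p' ∧ q = q') ∨
      (X.ph i p ≤ Y.ep i q ∧ p = p' ∧ Y.F i q = some q') := by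
  by_cases h : Y.ep i q < X.ph i p
  · simp [tensor, h]
  · simp [tensor, h, not_lt.1 h, and_comm]

theorem tensor_E_iff {i : ℕ} {p p' : X.V} {q q' : Y.V} :
    (tensor X Y).E i (p, q) = some (p', q') ↔
      (Y.ep i q ≤ X.ph i p ∧ X.E i p = some p' ∧ q = q') ∨
      (X.ph i p < Y.ep i q ∧ p = p' ∧ Y.E i q = some q') := by
  by_cases h : Y.ep i q ≤ X.ph i p
  · simp [tensor, h]
  · simp [tensor, h, not_le.1 h, and_comm]

theorem tensor_F_left {i : ℕ} {p p' : X.V} {q : Y.V} (h : Y.ep i q < X.ph i p)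
    (hp : X.F i p = some p') : (tensor X Y).F i (p, q) = some (p', q) :=
  tensor_F_iff.2 (Or.inl ⟨h, hp, rfl⟩)

theorem tensor_F_right {i : ℕ} {p : X.V} {q q' : Y.V} (h : X.ph i p ≤ Y.ep i q)
    (hq : Y.F i q = some q') : (tensor X Y).F i (p, q) = some (p, q') :=
  tensor_F_iff.2 (Or.inr ⟨h, rfl, hq⟩)

theorem tensor_verma_left (hX : X.Regular C) {i j : ℕ} (hi : i ∈ C) (hj : j ∈ C)
    (hij : Neighb i j) {p p₁ p₂ : X.V} {q : Y.V}
    (h1 : X.F i p = some p₁) (h2 : X.F j p = some p₂)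
    (l1 : X.ph j p₁ = X.ph j p + 1) (l2 : X.ph i p₂ = X.ph i p + 1)
    (hi' : Y.ep i q < X.ph i p) (hj' : Y.ep j q < X.ph j p) :
    ∃ a b w, (tensor X Y).F j (p₁, q) = some a ∧ (tensor X Y).F j a = some b ∧
      (tensor X Y).F i b = some (w, q) ∧
    ∃ a' b', (tensor X Y).F i (p₂, q) = some a' ∧ (tensor X Y).F i a' = some b' ∧
      (tensor X Y).F j b' = some (w, q) := by
  have hF := hX.1
  obtain ⟨a, b, a', b', w, ha, hb, hw, ha', hb', hw'⟩ :=
    hF.verma i hi j hj hij p p₁ p₂ h1 h2 l1 l2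
  have s1 := hF.step i hi _ _ h1
  have s2 := hF.step j hj _ _ h2
  have s3 := hF.step j hj _ _ ha
  have s4 := hF.step j hj _ _ hb
  have s5 := hF.step i hi _ _ hw
  have s3' := hF.step i hi _ _ ha'
  have s4' := hF.step i hi _ _ hb'
  have s5' := hF.step j hj _ _ hw'
  have n3 := hF.near i hi j hj hij _ _ hw
  have n4 := hF.near j hj i hi hij.symm _ _ hw'
  exact ⟨(a, q), (b, q), w, tensor_F_left (by omega) ha, tensor_F_left (by omega) hb,
    tensor_F_left (by omega) hw, (a', q), (b', q), tensor_F_left (by omega) ha',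
    tensor_F_left (by omega) hb', tensor_F_left (by omega) hw'⟩

theorem tensor_verma_right (hY : Y.Regular C) {i j : ℕ} (hi : i ∈ C) (hj : j ∈ C)
    (hij : Neighb i j) {p : X.V} {q q₁ q₂ : Y.V}
    (h1 : Y.F i q = some q₁) (h2 : Y.F j q = some q₂)
    (l1 : Y.ph j q₁ = Y.ph j q + 1) (l2 : Y.ph i q₂ = Y.ph i q + 1)
    (hi' : X.ph i p ≤ Y.ep i q) (hj' : X.ph j p ≤ Y.ep j q) :
    ∃ a b w, (tensor X Y).F j (p, q₁) = some a ∧ (tensor X Y).F j a = some b ∧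
      (tensor X Y).F i b = some w ∧
    ∃ a' b', (tensor X Y).F i (p, q₂) = some a' ∧ (tensor X Y).F i a' = some b' ∧
      (tensor X Y).F j b' = some w := by
  have hF := hY.1
  obtain ⟨a, b, a', b', w, ha, hb, hw, ha', hb', hw'⟩ :=
    hF.verma i hi j hj hij q q₁ q₂ h1 h2 l1 l2
  have s1 := hF.step i hi _ _ h1
  have s2 := hF.step j hj _ _ h2
  have s3 := hF.step j hj _ _ ha
  have s4 := hF.step j hj _ _ hb
  have s5 := hF.step i hi _ _ hw
  have s3' := hF.step i hi _ _ ha'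
  have s4' := hF.step i hi _ _ hb'
  have s5' := hF.step j hj _ _ hw'
  have n1 := hF.near i hi j hj hij _ _ h1
  have n2 := hF.near j hj i hi hij.symm _ _ h2
  have n3 := hF.near i hi j hj hij _ _ hw
  have n4 := hF.near j hj i hi hij.symm _ _ hw'
  exact ⟨(p, a), (p, b), (p, w), tensor_F_right (by omega) ha, tensor_F_right (by omega) hb,
    tensor_F_right (by omega) hw, (p, a'), (p, b'), tensor_F_right (by omega) ha',
    tensor_F_right (by omega) hb', tensor_F_right (by omega) hw'⟩

/-- Both operators act on the right factor, where they commute; the Verma relation then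
involves the left factor. -/
theorem tensor_verma_right_of_comm (hX : X.Regular C) (hY : Y.Regular C) {i j : ℕ}
    (hi : i ∈ C) (hj : j ∈ C) (hij : Neighb i j) {p : X.V} {q q₁ q₂ : Y.V}
    (h1 : Y.F i q = some q₁) (h2 : Y.F j q = some q₂)
    (l1 : Y.ph j q₁ = Y.ph j q)
    (hi' : X.ph i p ≤ Y.ep i q) (hj' : X.ph j p = Y.ep j q) :
    ∃ a b w, (tensor X Y).F j (p, q₁) = some a ∧ (tensor X Y).F j a = some b ∧
      (tensor X Y).F i b = some w ∧
    ∃ a' b', (tensor X Y).F i (p, q₂) = some a' ∧ (tensor X Y).F i a' = some b' ∧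
      (tensor X Y).F j b' = some w := by
  have hF := hY.1
  obtain ⟨l2, r, hr, hr'⟩ := hF.near_comm i hi j hj hij q q₁ q₂ h1 h2 l1
  have s1 := hF.step i hi _ _ h1
  have s2 := hF.step j hj _ _ h2
  have n1 := hF.near i hi j hj hij _ _ h1
  have n2 := hF.near j hj i hi hij.symm _ _ h2
  have s3 := hF.step j hj _ _ hr
  have s4 := hF.step i hi _ _ hr'
  obtain ⟨r', hrr⟩ := (hF.pos i hi r).1 (by omega)
  obtain ⟨p₁, hp⟩ := (hX.1.pos j hj p).1 (by omega)
  have hlab := hY.label_after_square hi hj hij h1 h2 l1 hr' hrr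
  have s5 := hF.step i hi _ _ hrr
  have n5 := hF.near i hi j hj hij _ _ hrr
  have s6 := hX.1.step j hj _ _ hp
  have n6 := hX.1.near j hj i hi hij.symm _ _ hp
  exact ⟨(p₁, q₁), (p₁, r), (p₁, r'), tensor_F_left (by omega) hp,
    tensor_F_right (by omega) hr, tensor_F_right (by omega) hrr,
    (p, r), (p, r'), tensor_F_right (by omega) hr', tensor_F_right (by omega) hrr,
    tensor_F_left (by omega) hp⟩

/-- The operators act on different factors. -/
theorem tensor_verma_mixed (hX : X.Regular C) (hY : Y.Regular C) {i j : ℕ}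
    (hi : i ∈ C) (hj : j ∈ C) (hij : Neighb i j) {p p₁ : X.V} {q q₂ : Y.V}
    (h1 : X.F i p = some p₁) (h2 : Y.F j q = some q₂)
    (l1 : X.ph j p₁ = X.ph j p + 1)
    (hi' : Y.ep i q < X.ph i p) (hj' : X.ph j p = Y.ep j q) :
    ∃ a b w, (tensor X Y).F j (p₁, q) = some a ∧ (tensor X Y).F j a = some b ∧
      (tensor X Y).F i b = some w ∧
    ∃ a' b', (tensor X Y).F i (p, q₂) = some a' ∧ (tensor X Y).F i a' = some b' ∧
      (tensor X Y).F j b' = some w := by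
  have s1 := hX.1.step i hi _ _ h1
  have s2 := hY.1.step j hj _ _ h2
  have n1 := hX.1.near i hi j hj hij _ _ h1
  have n2 := hY.1.near j hj i hi hij.symm _ _ h2
  obtain ⟨r, hr⟩ := (hX.1.pos j hj p₁).1 (by omega)
  have s3 := hX.1.step j hj _ _ hr
  have n3 := hX.1.near j hj i hi hij.symm _ _ hr
  have lr := hX.label_after_raise hi hj hij h1 hr l1
  have f1 : (tensor X Y).F j (p₁, q) = some (r, q) := tensor_F_left (by omega) hr
  have f2 : (tensor X Y).F j (r, q) = some (r, q₂) := tensor_F_right (by omega) h2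
  have f3 : (tensor X Y).F i (p, q₂) = some (p₁, q₂) := tensor_F_left (by omega) h1
  by_cases hc : Y.ep i q₂ < X.ph i p₁
  · obtain ⟨r₂, hr₂⟩ := (hX.1.pos i hi p₁).1 (by omega)
    obtain ⟨l3, w, hw, hw'⟩ := hX.1.near_comm j hj i hi hij.symm p₁ r r₂ hr hr₂ lr
    exact ⟨_, _, (w, q₂), f1, f2, tensor_F_left (by omega) hw, _, (r₂, q₂), f3,
      tensor_F_left hc hr₂, tensor_F_left (by omega) hw'⟩
  · obtain ⟨q₃, hq₃⟩ := (hY.1.pos i hi q₂).1 (by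
      obtain h | h := n2
      · omega
      · omega)
    have lq := hY.label_after_raise hj hi hij.symm h2 hq₃ (by omega)
    have n5 := hY.1.near i hi j hj hij _ _ hq₃
    exact ⟨_, _, (r, q₃), f1, f2, tensor_F_right (by omega) hq₃, _, (p₁, q₃), f3,
      tensor_F_right (by omega) hq₃, tensor_F_left (by omega) hr⟩

theorem tensor_forward (hX : X.Regular C) (hY : Y.Regular C) : (tensor X Y).Forward C where
  inv := by
    rintro i hi ⟨p, q⟩ ⟨p', q'⟩
    refine tensor_F_iff.trans (Iff.trans ?_ tensor_E_iff.symm)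
    constructor
    · rintro (⟨h, hp, rfl⟩ | ⟨h, rfl, hq⟩)
      · have := hX.1.step i hi _ _ hp
        exact Or.inl ⟨by omega, (hX.1.inv i hi _ _).1 hp, rfl⟩
      · have := hY.1.step i hi _ _ hq
        exact Or.inr ⟨by omega, rfl, (hY.1.inv i hi _ _).1 hq⟩
    · rintro (⟨h, hp, rfl⟩ | ⟨h, rfl, hq⟩)
      · replace hp := (hX.1.inv i hi _ _).2 hp
        have := hX.1.step i hi _ _ hp
        exact Or.inl ⟨by omega, hp, rfl⟩
      · replace hq := (hY.1.inv i hi _ _).2 hq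
        have := hY.1.step i hi _ _ hq
        exact Or.inr ⟨by omega, rfl, hq⟩
  pos := by
    rintro i hi ⟨p, q⟩
    change 0 < Y.ph i q + (X.ph i p - Y.ep i q) ↔ _
    constructor
    · intro h
      by_cases hc : Y.ep i q < X.ph i p
      · obtain ⟨v, hv⟩ := (hX.1.pos i hi p).1 (by omega)
        exact ⟨_, tensor_F_left hc hv⟩
      · obtain ⟨v, hv⟩ := (hY.1.pos i hi q).1 (by omega)
        exact ⟨_, tensor_F_right (not_lt.1 hc) hv⟩
    · rintro ⟨⟨p', q'⟩, h⟩
      obtain ⟨h, hp, rfl⟩ | ⟨h, rfl, hq⟩ := tensor_F_iff.1 h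
      · omega
      · have := (hY.1.pos i hi q).2 ⟨_, hq⟩
        omega
  step := by
    rintro i hi ⟨p, q⟩ ⟨p', q'⟩ h
    simp only [tensor]
    obtain ⟨h, hp, rfl⟩ | ⟨h, rfl, hq⟩ := tensor_F_iff.1 h
    · have := hX.1.step i hi _ _ hp
      omega
    · have := hY.1.step i hi _ _ hq
      omega
  near := by
    rintro i hi j hj hij ⟨p, q⟩ ⟨p', q'⟩ h
    simp only [tensor]
    obtain ⟨h, hp, rfl⟩ | ⟨h, rfl, hq⟩ := tensor_F_iff.1 h
    · have := hX.1.near i hi j hj hij _ _ hp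
      omega
    · have := hY.1.near i hi j hj hij _ _ hq
      omega
  far := by
    rintro i hi j hj hij ⟨p, q⟩ ⟨p', q'⟩ h
    simp only [tensor]
    obtain ⟨h, hp, rfl⟩ | ⟨h, rfl, hq⟩ := tensor_F_iff.1 h
    · have := hX.1.far i hi j hj hij _ _ hp
      omega
    · have := hY.1.far i hi j hj hij _ _ hq
      omega
  far_comm := by
    rintro i hi j hj hij ⟨p, q⟩ ⟨p₁, q₁⟩ ⟨p₂, q₂⟩ h h'
    obtain ⟨h, hp, rfl⟩ | ⟨h, rfl, hq⟩ := tensor_F_iff.1 h <;>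
      obtain ⟨h', hp', rfl⟩ | ⟨h', rfl, hq'⟩ := tensor_F_iff.1 h'
    · have f1 := hX.1.far i hi j hj hij _ _ hp
      have f2 := hX.1.far j hj i hi hij.symm _ _ hp'
      obtain ⟨w, hw, hw'⟩ := hX.1.far_comm i hi j hj hij _ _ _ hp hp'
      exact ⟨(w, q), tensor_F_left (by omega) hw, tensor_F_left (by omega) hw'⟩
    · have f1 := hX.1.far i hi j hj hij _ _ hp
      have f2 := hY.1.far j hj i hi hij.symm _ _ hq'
      exact ⟨(p₁, q₂), tensor_F_right (by omega) hq', tensor_F_left (by omega) hp⟩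
    · have f1 := hY.1.far i hi j hj hij _ _ hq
      have f2 := hX.1.far j hj i hi hij.symm _ _ hp'
      exact ⟨(p₂, q₁), tensor_F_left (by omega) hp', tensor_F_right (by omega) hq⟩
    · have f1 := hY.1.far i hi j hj hij _ _ hq
      have f2 := hY.1.far j hj i hi hij.symm _ _ hq'
      obtain ⟨w, hw, hw'⟩ := hY.1.far_comm i hi j hj hij _ _ _ hq hq'
      exact ⟨(p, w), tensor_F_right (by omega) hw, tensor_F_right (by omega) hw'⟩
  near_comm := by
    rintro i hi j hj hij ⟨p, q⟩ ⟨p₁, q₁⟩ ⟨p₂, q₂⟩ h h' hl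
    simp only [tensor] at hl
    obtain ⟨h, hp, rfl⟩ | ⟨h, rfl, hq⟩ := tensor_F_iff.1 h <;>
      obtain ⟨h', hp', rfl⟩ | ⟨h', rfl, hq'⟩ := tensor_F_iff.1 h'
    · have n1 := hX.1.near i hi j hj hij _ _ hp
      obtain ⟨l, w, hw, hw'⟩ := hX.1.near_comm i hi j hj hij _ _ _ hp hp' (by omega)
      exact ⟨by simp only [tensor]; omega, (w, q), tensor_F_left (by omega) hw,
        tensor_F_left (by omega) hw'⟩
    · have n1 := hX.1.near i hi j hj hij _ _ hp
      have n2 := hY.1.near j hj i hi hij.symm _ _ hq'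
      exact ⟨by simp only [tensor]; omega, (p₁, q₂), tensor_F_right (by omega) hq',
        tensor_F_left (by omega) hp⟩
    · have n1 := hY.1.near i hi j hj hij _ _ hq
      omega
    · have n1 := hY.1.near i hi j hj hij _ _ hq
      have n2 := hY.1.near j hj i hi hij.symm _ _ hq'
      obtain ⟨l, w, hw, hw'⟩ := hY.1.near_comm i hi j hj hij _ _ _ hq hq' (by omega)
      exact ⟨by simp only [tensor]; omega, (p, w), tensor_F_right (by omega) hw,
        tensor_F_right (by omega) hw'⟩
  verma := by
    rintro i hi j hj hij ⟨p, q⟩ ⟨p₁, q₁⟩ ⟨p₂, q₂⟩ e e' l1 l2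
    simp only [tensor] at l1 l2
    obtain ⟨h, hp, rfl⟩ | ⟨h, rfl, hq⟩ := tensor_F_iff.1 e <;>
      obtain ⟨h', hp', rfl⟩ | ⟨h', rfl, hq'⟩ := tensor_F_iff.1 e'
    · obtain ⟨a, b, w, h1, h2, h3, a', b', h4, h5, h6⟩ :=
        tensor_verma_left (Y := Y) (q := q) hX hi hj hij hp hp' (by omega) (by omega) h h'
      exact ⟨a, b, a', b', _, h1, h2, h3, h4, h5, h6⟩
    · have n1 := hX.1.near i hi j hj hij _ _ hp
      obtain ⟨a, b, w, h1, h2, h3, a', b', h4, h5, h6⟩ :=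
        tensor_verma_mixed hX hY hi hj hij hp hq' (by omega) h (by omega)
      exact ⟨a, b, a', b', _, h1, h2, h3, h4, h5, h6⟩
    · have n1 := hX.1.near j hj i hi hij.symm _ _ hp'
      obtain ⟨a, b, w, h1, h2, h3, a', b', h4, h5, h6⟩ :=
        tensor_verma_mixed hX hY hj hi hij.symm hp' hq (by omega) h' (by omega)
      exact ⟨a', b', a, b, _, h4, h5, h6, h1, h2, h3⟩
    · have n1 := hY.1.near i hi j hj hij _ _ hq
      have n2 := hY.1.near j hj i hi hij.symm _ _ hq'
      by_cases c1 : Y.ph j q₁ = Y.ph j q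
      · obtain ⟨a, b, w, h1, h2, h3, a', b', h4, h5, h6⟩ :=
          tensor_verma_right_of_comm hX hY hi hj hij hq hq' c1 h (by omega)
        exact ⟨a, b, a', b', _, h1, h2, h3, h4, h5, h6⟩
      by_cases c2 : Y.ph i q₂ = Y.ph i q
      · obtain ⟨a, b, w, h1, h2, h3, a', b', h4, h5, h6⟩ :=
          tensor_verma_right_of_comm hX hY hj hi hij.symm hq' hq c2 h' (by omega)
        exact ⟨a', b', a, b, _, h4, h5, h6, h1, h2, h3⟩
      obtain ⟨a, b, w, h1, h2, h3, a', b', h4, h5, h6⟩ :=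
        tensor_verma_right (X := X) (p := p) hY hi hj hij hq hq' (by omega) (by omega) h h'
      exact ⟨a, b, a', b', _, h1, h2, h3, h4, h5, h6⟩

/-- The forward axioms are invariant under isomorphism. -/
theorem Forward.of_equiv (e : X.V ≃ Y.V) (hF : ∀ i u, Y.F i (e u) = (X.F i u).map e)
    (hE : ∀ i u, Y.E i (e u) = (X.E i u).map e) (hep : ∀ i u, Y.ep i (e u) = X.ep i u)
    (hph : ∀ i u, Y.ph i (e u) = X.ph i u) (h : Y.Forward C) : X.Forward C := by
  have kF : ∀ i u v, X.F i u = some v ↔ Y.F i (e u) = some (e v) := by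
    intro i u v; rw [hF]; cases X.F i u <;> simp
  have kE : ∀ i u v, X.E i u = some v ↔ Y.E i (e u) = some (e v) := by
    intro i u v; rw [hE]; cases X.E i u <;> simp
  have ex : ∀ P : Y.V → Prop, (∃ w, P w) → ∃ w, P (e w) := fun P ⟨w, hw⟩ =>
    ⟨e.symm w, by simpa using hw⟩
  constructor
  · intro i hi u v
    rw [kF, kE, h.inv i hi]
  · intro i hi u
    simp only [kF, ← hph]
    exact (h.pos i hi (e u)).trans ⟨ex _, fun ⟨w, hw⟩ => ⟨_, hw⟩⟩
  · intro i hi u v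
    simp only [kF, ← hph, ← hep]
    exact h.step i hi _ _
  · intro i hi j hj hij u v
    simp only [kF, ← hph, ← hep]
    exact h.near i hi j hj hij _ _
  · intro i hi j hj hij u v
    simp only [kF, ← hph, ← hep]
    exact h.far i hi j hj hij _ _
  · intro i hi j hj hij u v v'
    simp only [kF]
    exact fun h1 h2 => ex _ (h.far_comm i hi j hj hij _ _ _ h1 h2)
  · intro i hi j hj hij u v v'
    simp only [kF, ← hph]
    intro h1 h2 h3
    obtain ⟨h4, h5⟩ := h.near_comm i hi j hj hij _ _ _ h1 h2 h3
    exact ⟨h4, ex _ h5⟩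
  · intro i hi j hj hij u v v'
    simp only [kF, ← hph]
    intro h1 h2 h3 h4
    obtain ⟨p, q, p', q', w, h5⟩ := h.verma i hi j hj hij _ _ _ h1 h2 h3 h4
    exact ⟨e.symm p, e.symm q, e.symm p', e.symm q', e.symm w, by simpa using h5⟩

theorem Regular.tensor (hX : X.Regular C) (hY : Y.Regular C) : (tensor X Y).Regular C := by
  refine ⟨tensor_forward hX hY,
    Forward.of_equiv (Y := ECrystal.tensor Y.dual X.dual) (Equiv.prodComm X.V Y.V) ?_ ?_ ?_ ?_
      (tensor_forward hY.dual hX.dual)⟩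
  · rintro i ⟨p, q⟩
    change (if X.ph i p < Y.ep i q then (Y.E i q).map (fun r => (r, p))
      else (X.E i p).map (fun r => (q, r))) =
      Option.map Prod.swap (if Y.ep i q ≤ X.ph i p then (X.E i p).map (fun r => (r, q))
        else (Y.E i q).map (fun r => (p, r)))
    by_cases h : Y.ep i q ≤ X.ph i p
    · rw [if_pos h, if_neg (not_lt.2 h), Option.map_map]
      rfl
    · rw [if_neg h, if_pos (not_le.1 h), Option.map_map]
      rfl
  · rintro i ⟨p, q⟩
    change (if X.ph i p ≤ Y.ep i q then (Y.F i q).map (fun r => (r, p))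
      else (X.F i p).map (fun r => (q, r))) =
      Option.map Prod.swap (if Y.ep i q < X.ph i p then (X.F i p).map (fun r => (r, q))
        else (Y.F i q).map (fun r => (p, r)))
    by_cases h : Y.ep i q < X.ph i p
    · rw [if_pos h, if_neg (not_le.2 h), Option.map_map]
      rfl
    · rw [if_neg h, if_pos (not_lt.1 h), Option.map_map]
      rfl
  · rintro i ⟨p, q⟩
    rfl
  · rintro i ⟨p, q⟩
    rfl

/-- Pairs of vertices reached from `(x₀, y₀)` by a common string of `r` operators with
colors in `C`. -/
inductive Track (X Y : ECrystal) (C : Set ℕ) (x₀ : X.V) (y₀ : Y.V) : ℕ → X.V → Y.V → Prop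
  | refl : Track X Y C x₀ y₀ 0 x₀ y₀
  | step {r i x y x' y'} (hi : i ∈ C) (h : Track X Y C x₀ y₀ r x y)
      (hx : X.F i x = some x') (hy : Y.F i y = some y') : Track X Y C x₀ y₀ (r + 1) x' y'

theorem Track.swap {x₀ : X.V} {y₀ : Y.V} {r : ℕ} {x : X.V} {y : Y.V}
    (h : Track X Y C x₀ y₀ r x y) : Track Y X C y₀ x₀ r y x := by
  induction h with
  | refl => exact .refl
  | step hi _ hx hy ih => exact .step hi ih hy hx

/-- Tracked pairs at depth `r` have equal statistics, and every edge entering the first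
vertex is matched by an edge entering the second. -/
def Liftable (X Y : ECrystal) (C : Set ℕ) (x₀ : X.V) (y₀ : Y.V) (r : ℕ) : Prop :=
  ∀ x y, Track X Y C x₀ y₀ r x y → ∀ j ∈ C, X.ph j x = Y.ph j y ∧ X.ep j x = Y.ep j y ∧
    ∀ x₁, X.E j x = some x₁ →
      ∃ r' y₁, r = r' + 1 ∧ Y.E j y = some y₁ ∧ Track X Y C x₀ y₀ r' x₁ y₁

theorem Liftable.exists_step {x₀ : X.V} {y₀ : Y.V} {r : ℕ} (hL : Liftable X Y C x₀ y₀ r)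
    (hX : X.Regular C) (hY : Y.Regular C) {i : ℕ} (hi : i ∈ C) {x x' : X.V} {y : Y.V}
    (h : Track X Y C x₀ y₀ r x y) (hx : X.F i x = some x') :
    ∃ y', Y.F i y = some y' ∧ Track X Y C x₀ y₀ (r + 1) x' y' := by
  have h1 := (hX.1.pos i hi x).2 ⟨_, hx⟩
  rw [(hL x y h i hi).1] at h1
  obtain ⟨y', hy'⟩ := (hY.1.pos i hi y).1 h1
  exact ⟨y', hy', .step hi h hx hy'⟩

theorem Regular.lift_edge (hX : X.Regular C) (hY : Y.Regular C) {x₀ : X.V} {y₀ : Y.V} {r : ℕ}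
    (hL : ∀ r' ≤ r, Liftable X Y C x₀ y₀ r') {i j : ℕ} (hi : i ∈ C) (hj : j ∈ C)
    {x₁ x x₂ : X.V} {y₁ y : Y.V} (h : Track X Y C x₀ y₀ r x₁ y₁)
    (hx : X.F i x₁ = some x) (hy : Y.F i y₁ = some y) (hx₂ : X.E j x = some x₂) :
    ∃ y₂, Y.E j y = some y₂ ∧ Track X Y C x₀ y₀ r x₂ y₂ := by
  have hEx : X.E i x = some x₁ := (hX.1.inv i hi _ _).1 hx
  have hFx₂ : X.F j x₂ = some x := (hX.1.inv j hj _ _).2 hx₂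
  have toE : ∀ y₂, Y.F j y₂ = some y → Y.E j y = some y₂ := fun y₂ => (hY.1.inv j hj _ _).1
  obtain rfl | hij | hij : i = j ∨ Neighb i j ∨ Far i j := by unfold Neighb Far; omega
  · rw [hEx] at hx₂
    obtain rfl := Option.some.inj hx₂
    exact ⟨y₁, (hY.1.inv i hi _ _).1 hy, h⟩
  · have s1 := hX.1.step i hi _ _ hx
    have s2 := hX.1.step j hj _ _ hFx₂
    have n1 := hX.1.near i hi j hj hij _ _ hx
    have n2 := hX.1.near j hj i hi hij.symm _ _ hFx₂
    -- the commuting case, with the label information at the top of the square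
    have square : ∀ z, X.E j x₁ = some z → X.E i x₂ = some z →
        (X.ph i x₁ = X.ph i z ∨ X.ph j x₂ = X.ph j z) →
        ∃ y₂, Y.E j y = some y₂ ∧ Track X Y C x₀ y₀ r x₂ y₂ := by
      intro z hz hz' hlab
      obtain ⟨r', z', rfl, hz₁, hT⟩ := (hL r le_rfl x₁ y₁ h j hj).2.2 z hz
      obtain ⟨y₂, hy₂, hT₂⟩ := (hL r' (by omega)).exists_step hX hY hi hT
        ((hX.1.inv i hi _ _).2 hz')
      have hy₁ : Y.F j z' = some y₁ := (hY.1.inv j hj _ _).2 hz₁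
      refine ⟨y₂, toE y₂ ?_, hT₂⟩
      rw [(hL (r' + 1) le_rfl _ _ h i hi).1, (hL r' (by omega) _ _ hT i hi).1,
        (hL (r' + 1) le_rfl _ _ hT₂ j hj).1, (hL r' (by omega) _ _ hT j hj).1] at hlab
      obtain hl | hl := hlab
      · obtain ⟨-, w, hw, hw'⟩ := hY.1.near_comm j hj i hi hij.symm _ _ _ hy₁ hy₂ hl
        rw [hw', ← hw, hy]
      · obtain ⟨-, w, hw, hw'⟩ := hY.1.near_comm i hi j hj hij _ _ _ hy₂ hy₁ hl
        rw [hw, ← hw', hy]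
    by_cases c1 : X.ep j x₁ = X.ep j x
    · obtain ⟨l, z, hz, hz'⟩ := hX.2.near_comm i hi j hj hij x x₁ x₂ hEx hx₂ c1
      change X.ep i x₂ = X.ep i x + 1 at l
      have s3 := hX.1.step i hi _ _ ((hX.1.inv i hi _ _).2 hz')
      have n3 := hX.1.near j hj i hi hij.symm _ _ ((hX.1.inv j hj _ _).2 hz)
      exact square z hz hz' (Or.inl (by omega))
    by_cases c2 : X.ep i x₂ = X.ep i x
    · obtain ⟨l, z, hz, hz'⟩ := hX.2.near_comm j hj i hi hij.symm x x₂ x₁ hx₂ hEx c2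
      change X.ep j x₁ = X.ep j x + 1 at l
      have s3 := hX.1.step j hj _ _ ((hX.1.inv j hj _ _).2 hz')
      have n3 := hX.1.near i hi j hj hij _ _ ((hX.1.inv i hi _ _).2 hz)
      exact square z hz' hz (Or.inr (by omega))
    have l1 : X.ep j x₁ = X.ep j x + 1 := by omega
    have l2 : X.ep i x₂ = X.ep i x + 1 := by omega
    obtain ⟨b, a, b', a', z, e1, e2, e3, e1', e2', e3'⟩ :=
      hX.2.verma i hi j hj hij x x₁ x₂ hEx hx₂ l1 l2
    obtain ⟨r₁, yb, rfl, hyb, Tb⟩ := (hL r le_rfl x₁ y₁ h j hj).2.2 b e1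
    obtain ⟨r₂, ya, rfl, hya, Ta⟩ := (hL r₁ (by omega) _ _ Tb j hj).2.2 a e2
    obtain ⟨r₃, yz, rfl, hyz, Tz⟩ := (hL r₂ (by omega) _ _ Ta i hi).2.2 z e3
    have f1 := (hX.1.inv j hj _ _).2 e1
    have f2 := (hX.1.inv j hj _ _).2 e2
    have f3 := (hX.1.inv i hi _ _).2 e3
    have f1' := (hX.1.inv i hi _ _).2 e1'
    have f2' := (hX.1.inv i hi _ _).2 e2'
    have f3' := (hX.1.inv j hj _ _).2 e3'
    have t1 := hX.verma_top hi hj hij f3 f2 f1 hx f3' f2' f1' hFx₂ l1 l2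
    have t2 := hX.verma_top hj hi hij.symm f3' f2' f1' hFx₂ f3 f2 f1 hx l2 l1
    obtain ⟨ya', hya', Ta'⟩ := (hL r₃ (by omega)).exists_step hX hY hj Tz f3'
    obtain ⟨yb', hyb', Tb'⟩ := (hL (r₃ + 1) (by omega)).exists_step hX hY hi Ta' f2'
    obtain ⟨y₂, hy₂, T₂⟩ := (hL (r₃ + 1 + 1) (by omega)).exists_step hX hY hi Tb' f1'
    refine ⟨y₂, toE y₂ ?_, T₂⟩
    rw [(hL _ (by omega) _ _ Ta j hj).1, (hL _ (by omega) _ _ Tz j hj).1] at t1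
    rw [(hL _ (by omega) _ _ Ta' i hi).1, (hL _ (by omega) _ _ Tz i hi).1] at t2
    obtain ⟨p, q, p', q', w, g1, g2, g3, g1', g2', g3'⟩ := hY.1.verma i hi j hj hij yz ya ya'
      ((hY.1.inv i hi _ _).2 hyz) hya' t1 t2
    rw [(hY.1.inv j hj _ _).2 hya] at g1
    obtain rfl := Option.some.inj g1
    rw [(hY.1.inv j hj _ _).2 hyb] at g2
    obtain rfl := Option.some.inj g2
    rw [hyb'] at g1'
    obtain rfl := Option.some.inj g1'
    rw [hy₂] at g2'
    obtain rfl := Option.some.inj g2'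
    rw [g3', ← g3, hy]
  · obtain ⟨z, hz, hz'⟩ := hX.2.far_comm i hi j hj hij x x₁ x₂ hEx hx₂
    obtain ⟨r', z', rfl, hz₁, hT⟩ := (hL r le_rfl x₁ y₁ h j hj).2.2 z hz
    obtain ⟨y₂, hy₂, hT₂⟩ := (hL r' (by omega)).exists_step hX hY hi hT
      ((hX.1.inv i hi _ _).2 hz')
    have hy₁ : Y.F j z' = some y₁ := (hY.1.inv j hj _ _).2 hz₁
    obtain ⟨w, hw, hw'⟩ := hY.1.far_comm i hi j hj hij _ _ _ hy₂ hy₁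
    refine ⟨y₂, toE y₂ ?_, hT₂⟩
    rw [hw, ← hw', hy]

/-- Two regular crystals are indistinguishable below vertices without incoming edges that
have the same string lengths. -/
theorem Regular.liftable (hX : X.Regular C) (hY : Y.Regular C) {x₀ : X.V} {y₀ : Y.V}
    (hx₀ : ∀ i ∈ C, X.ep i x₀ = 0) (hy₀ : ∀ i ∈ C, Y.ep i y₀ = 0)
    (hph : ∀ i ∈ C, X.ph i x₀ = Y.ph i y₀) (r : ℕ) :
    Liftable X Y C x₀ y₀ r ∧ Liftable Y X C y₀ x₀ r := by
  have noE : ∀ {Z : ECrystal}, Z.Regular C → ∀ z : Z.V, ∀ i ∈ C, Z.ep i z = 0 →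
      ∀ z₁, Z.E i z ≠ some z₁ := by
    intro Z hZ z i hi h0 z₁ hz
    have := (hZ.2.pos i hi z).2 ⟨z₁, hz⟩
    change 0 < Z.ep i z at this
    omega
  induction r using Nat.strong_induction_on with
  | _ r ih =>
  cases r with
  | zero =>
    constructor
    · intro x y h j hj
      cases h
      exact ⟨hph j hj, (hx₀ j hj).trans (hy₀ j hj).symm,
        fun x₁ h1 => absurd h1 (noE hX _ j hj (hx₀ j hj) x₁)⟩
    · intro x y h j hj
      cases h
      exact ⟨(hph j hj).symm, (hy₀ j hj).trans (hx₀ j hj).symm,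
        fun x₁ h1 => absurd h1 (noE hY _ j hj (hy₀ j hj) x₁)⟩
  | succ r =>
    have hL : ∀ r' ≤ r, Liftable X Y C x₀ y₀ r' := fun r' h => (ih r' (by omega)).1
    have hL' : ∀ r' ≤ r, Liftable Y X C y₀ x₀ r' := fun r' h => (ih r' (by omega)).2
    have stats : ∀ x y, Track X Y C x₀ y₀ (r + 1) x y → ∀ j ∈ C,
        (X.ph j x = Y.ph j y ∧ X.ep j x = Y.ep j y) ∧
        (∀ x₁, X.E j x = some x₁ → ∃ y₁, Y.E j y = some y₁ ∧ Track X Y C x₀ y₀ r x₁ y₁) ∧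
        (∀ y₁, Y.E j y = some y₁ → ∃ x₁, X.E j x = some x₁ ∧ Track X Y C x₀ y₀ r x₁ y₁) := by
      rintro x y (_ | @⟨_, i, x', y', _, _, hi, h, hx, hy⟩) j hj
      have d1 : ∀ x₁, X.E j x = some x₁ →
          ∃ y₁, Y.E j y = some y₁ ∧ Track X Y C x₀ y₀ r x₁ y₁ :=
        fun x₁ h1 => hX.lift_edge hY hL hi hj h hx hy h1
      have d2 : ∀ y₁, Y.E j y = some y₁ →
          ∃ x₁, X.E j x = some x₁ ∧ Track X Y C x₀ y₀ r x₁ y₁ := by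
        intro y₁ h1
        obtain ⟨x₁, h2, h3⟩ := hY.lift_edge hX hL' hi hj h.swap hy hx h1
        exact ⟨x₁, h2, h3.swap⟩
      refine ⟨?_, d1, d2⟩
      have hep : X.ep j x = Y.ep j y := by
        by_cases h0 : X.ep j x = 0
        · by_contra hne
          obtain ⟨y₁, hy₁⟩ := (hY.2.pos j hj y).1 (show 0 < Y.ep j y by omega)
          obtain ⟨x₁, hx₁, -⟩ := d2 y₁ hy₁
          exact noE hX x j hj h0 x₁ hx₁
        · obtain ⟨x₁, hx₁⟩ := (hX.2.pos j hj x).1 (show 0 < X.ep j x by omega)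
          obtain ⟨y₁, hy₁, hT⟩ := d1 x₁ hx₁
          have e1 := hX.1.step j hj _ _ ((hX.1.inv j hj _ _).2 hx₁)
          have e2 := hY.1.step j hj _ _ ((hY.1.inv j hj _ _).2 hy₁)
          have e3 := (hL r le_rfl _ _ hT j hj).2.1
          omega
      have e := hL r le_rfl _ _ h j hj
      refine ⟨?_, hep⟩
      obtain rfl | hij | hij : i = j ∨ Neighb i j ∨ Far i j := by unfold Neighb Far; omega
      · have e1 := hX.1.step i hi _ _ hx
        have e2 := hY.1.step i hi _ _ hy
        omega
      · have e1 := hX.1.near i hi j hj hij _ _ hx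
        have e2 := hY.1.near i hi j hj hij _ _ hy
        omega
      · have e1 := hX.1.far i hi j hj hij _ _ hx
        have e2 := hY.1.far i hi j hj hij _ _ hy
        omega
    constructor
    · intro x y h j hj
      obtain ⟨⟨h1, h2⟩, h3, -⟩ := stats x y h j hj
      exact ⟨h1, h2, fun x₁ hx₁ => let ⟨y₁, a, b⟩ := h3 x₁ hx₁; ⟨r, y₁, rfl, a, b⟩⟩
    · intro y x h j hj
      obtain ⟨⟨h1, h2⟩, -, h3⟩ := stats x y h.swap j hj
      exact ⟨h1.symm, h2.symm,
        fun x₁ hx₁ => let ⟨y₁, a, b⟩ := h3 x₁ hx₁; ⟨r, y₁, rfl, a, b.swap⟩⟩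

theorem Track.applyStr {x₀ : X.V} {y₀ : Y.V} {L : List ℕ} (hLC : ∀ i ∈ L, i ∈ C) {r : ℕ}
    {x x' : X.V} {y y' : Y.V} (h : Track X Y C x₀ y₀ r x y)
    (hx : applyStr X.toPreGraph L x = some x') (hy : applyStr Y.toPreGraph L y = some y') :
    ∃ r', Track X Y C x₀ y₀ r' x' y' := by
  induction L generalizing r x y with
  | nil =>
    obtain rfl : x = x' := Option.some.inj hx
    obtain rfl : y = y' := Option.some.inj hy
    exact ⟨r, h⟩
  | cons i L ih =>
    obtain ⟨x₁, hx₁, hx⟩ := Option.bind_eq_some_iff.1 hx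
    obtain ⟨y₁, hy₁, hy⟩ := Option.bind_eq_some_iff.1 hy
    exact ih (fun k hk => hLC k (List.mem_cons_of_mem _ hk))
      (.step (hLC i List.mem_cons_self) h hx₁ hy₁) hx hy

/-- A string ending at the second vertex of a tracked pair can be pulled back to a string
ending at the first vertex. -/
theorem Track.pull_back (hX : X.Regular C) (hY : Y.Regular C) {x₀ : X.V} {y₀ : Y.V}
    (hL : ∀ r, Liftable Y X C y₀ x₀ r) {L : List ℕ} (hLC : ∀ i ∈ L, i ∈ C) {r : ℕ}
    {x : X.V} {y y' : Y.V} (h : Track X Y C x₀ y₀ r x y)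
    (hy : _root_.applyStr Y.toPreGraph L y' = some y) :
    ∃ r' x', Track X Y C x₀ y₀ r' x' y' ∧ _root_.applyStr X.toPreGraph L x' = some x := by
  induction L generalizing y' with
  | nil =>
    obtain rfl : y' = y := Option.some.inj hy
    exact ⟨r, x, h, rfl⟩
  | cons i L ih =>
    obtain ⟨y₁, hy₁, hy⟩ := Option.bind_eq_some_iff.1 hy
    have hi : i ∈ C := hLC i List.mem_cons_self
    obtain ⟨r₁, x₁, hT, hx₁⟩ := ih (fun k hk => hLC k (List.mem_cons_of_mem _ hk)) hy
    obtain ⟨r', x', -, hx', hT'⟩ :=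
      (hL r₁ _ _ hT.swap i hi).2.2 y' ((hY.1.inv i hi _ _).1 hy₁)
    refine ⟨r', x', hT'.swap, ?_⟩
    change (X.F i x').bind _ = _
    rw [(hX.1.inv i hi _ _).2 hx']
    exact hx₁

theorem applyStr_cons_eq_some {K : PreGraph} {i : ℕ} {L : List ℕ} {v w : K.V} :
    applyStr K (i :: L) v = some w ↔ ∃ u, K.F i v = some u ∧ applyStr K L u = some w :=
  Option.bind_eq_some_iff

theorem applyStr_append {K : PreGraph} {L L' : List ℕ} {u v w : K.V}
    (h : applyStr K L u = some v) (h' : applyStr K L' v = some w) :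
    applyStr K (L ++ L') u = some w := by
  induction L generalizing u with
  | nil => obtain rfl : u = v := Option.some.inj h; exact h'
  | cons i L ih =>
    obtain ⟨x, hx, h⟩ := applyStr_cons_eq_some.1 h
    exact applyStr_cons_eq_some.2 ⟨x, hx, ih h⟩

theorem tensor_applyStr_left (hX : X.Forward C) {L : List ℕ} (hL : ∀ i ∈ L, i ∈ C)
    {p p' : X.V} {q : Y.V} (hq : ∀ i ∈ L, Y.ep i q = 0)
    (h : applyStr X.toPreGraph L p = some p') :
    applyStr (tensor X Y).toPreGraph L (p, q) = some (p', q) := by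
  induction L generalizing p with
  | nil => exact congrArg _ (Prod.ext (Option.some.inj h) rfl)
  | cons i L ih =>
    obtain ⟨u, hu, h⟩ := applyStr_cons_eq_some.1 h
    refine applyStr_cons_eq_some.2 ⟨(u, q), tensor_F_left ?_ hu,
      ih (fun j hj => hL j (List.mem_cons_of_mem _ hj))
        (fun j hj => hq j (List.mem_cons_of_mem _ hj)) h⟩
    rw [hq i List.mem_cons_self]
    exact (hX.pos i (hL i List.mem_cons_self) p).2 ⟨u, hu⟩

theorem tensor_applyStr_right {L : List ℕ} {p : X.V} {q q' : Y.V}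
    (hp : ∀ i ∈ L, X.ph i p = 0) (h : applyStr Y.toPreGraph L q = some q') :
    applyStr (tensor X Y).toPreGraph L (p, q) = some (p, q') := by
  induction L generalizing q with
  | nil => exact congrArg _ (Prod.ext rfl (Option.some.inj h))
  | cons i L ih =>
    obtain ⟨u, hu, h⟩ := applyStr_cons_eq_some.1 h
    refine applyStr_cons_eq_some.2 ⟨(p, u), tensor_F_right ?_ hu,
      ih (fun j hj => hp j (List.mem_cons_of_mem _ hj)) h⟩
    rw [hp i List.mem_cons_self]
    exact Nat.zero_le _

/-- Exchange the letters `i` and `i + 1` in a set of letters. -/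
def swapLetter (i : ℕ) (b : ℕ → Bool) : ℕ → Bool :=
  fun x => if x = i then b (i + 1) else if x = i + 1 then b i else b x

/-- The crystal of columns: vertices are sets of letters, and color `i` replaces the letter
`i` by `i + 1`. -/
def column : ECrystal where
  V := ℕ → Bool
  F i b := if b i = true ∧ b (i + 1) = false then some (swapLetter i b) else none
  E i b := if b i = false ∧ b (i + 1) = true then some (swapLetter i b) else none
  ep i b := if b i = false ∧ b (i + 1) = true then 1 else 0
  ph i b := if b i = true ∧ b (i + 1) = false then 1 else 0

theorem swapLetter_swapLetter (i : ℕ) (b : ℕ → Bool) : swapLetter i (swapLetter i b) = b := by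
  funext x
  unfold swapLetter
  grind

theorem column_F_iff {i : ℕ} {u v : ℕ → Bool} : column.F i u = some v ↔
    (u i = true ∧ u (i + 1) = false) ∧ swapLetter i u = v := by
  change (if _ then some _ else none) = some v ↔ _
  split_ifs with h <;> simp [h]

theorem column_E_iff {i : ℕ} {u v : ℕ → Bool} : column.E i u = some v ↔
    (u i = false ∧ u (i + 1) = true) ∧ swapLetter i u = v := by
  change (if _ then some _ else none) = some v ↔ _
  split_ifs with h <;> simp [h]

theorem column_forward (C : Set ℕ) : column.Forward C where
  inv i _ u v := by
    refine column_F_iff.trans (Iff.trans ⟨?_, ?_⟩ column_E_iff.symm)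
    · rintro ⟨h, rfl⟩
      exact ⟨by simpa [swapLetter] using h.symm, swapLetter_swapLetter i u⟩
    · rintro ⟨h, rfl⟩
      exact ⟨by simpa [swapLetter] using h.symm, swapLetter_swapLetter i v⟩
  pos i _ u := by
    refine Iff.trans ?_ (exists_congr fun v => column_F_iff.symm)
    simp only [column]
    split_ifs with h <;> simp [h]
  step i _ u v h := by
    obtain ⟨⟨h₁, h₂⟩, rfl⟩ := column_F_iff.1 h
    simp [column, swapLetter, h₁, h₂]
  near i _ j _ hij u v h := by
    obtain ⟨h, rfl⟩ := column_F_iff.1 h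
    simp only [column, swapLetter]
    rcases hij with rfl | rfl <;> grind
  far i _ j _ hij u v h := by
    obtain ⟨h, rfl⟩ := column_F_iff.1 h
    simp only [column, swapLetter]
    unfold Far at hij
    grind
  far_comm i _ j _ hij u v v' h h' := by
    obtain ⟨h, rfl⟩ := column_F_iff.1 h
    obtain ⟨h', rfl⟩ := column_F_iff.1 h'
    unfold Far at hij
    refine ⟨swapLetter j (swapLetter i u), column_F_iff.2 ⟨?_, rfl⟩, column_F_iff.2 ⟨?_, ?_⟩⟩
    · unfold swapLetter; grind
    · unfold swapLetter; grind
    · funext x; unfold swapLetter; grind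
  near_comm i _ j _ hij u v v' h h' _ := by
    have h := (column_F_iff.1 h).1
    have h' := (column_F_iff.1 h').1
    rcases hij with rfl | rfl <;> simp_all
  verma i _ j _ hij u v v' h h' _ _ := by
    have h := (column_F_iff.1 h).1
    have h' := (column_F_iff.1 h').1
    rcases hij with rfl | rfl <;> simp_all

theorem column_regular (C : Set ℕ) : column.Regular C := by
  refine ⟨column_forward C, Forward.of_equiv (X := column.dual) (Y := column)
    ⟨fun b x => !b x, fun b x => !b x, fun b => funext fun x => Bool.not_not (b x),
      fun b => funext fun x => Bool.not_not (b x)⟩ ?_ ?_ ?_ ?_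
    (column_forward C)⟩ <;> intro i (u : ℕ → Bool)
  · change (if (!u i) = true ∧ (!u (i + 1)) = false then some (swapLetter i fun x => !u x)
      else none) = Option.map (fun (b : ℕ → Bool) x => !b x)
        (if u i = false ∧ u (i + 1) = true then some (swapLetter i u) else none)
    simp only [Bool.not_eq_true', Bool.not_eq_false']
    split_ifs
    · refine congrArg some (funext fun x => ?_)
      unfold swapLetter
      grind
    · rfl
  · change (if (!u i) = false ∧ (!u (i + 1)) = true then some (swapLetter i fun x => !u x)
      else none) = Option.map (fun (b : ℕ → Bool) x => !b x)
        (if u i = true ∧ u (i + 1) = false then some (swapLetter i u) else none)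
    simp only [Bool.not_eq_true', Bool.not_eq_false']
    split_ifs
    · refine congrArg some (funext fun x => ?_)
      unfold swapLetter
      grind
    · rfl
  · change (if (!u i) = false ∧ (!u (i + 1)) = true then 1 else 0) =
      if u i = true ∧ u (i + 1) = false then 1 else 0
    simp only [Bool.not_eq_true', Bool.not_eq_false']
  · change (if (!u i) = true ∧ (!u (i + 1)) = false then 1 else 0) =
      if u i = false ∧ u (i + 1) = true then 1 else 0
    simp only [Bool.not_eq_true', Bool.not_eq_false']

/-- The column with letters `0`, `lo, …, lo + k - 1` and `M`. -/
def intervalColumn (lo k M : ℕ) : ℕ → Bool :=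
  fun x => decide (x = 0 ∨ (lo ≤ x ∧ x < lo + k) ∨ x = M)

theorem column_wStr {o k j M : ℕ} (hj : 1 ≤ o + j) (hM : M < o + j ∨ o + j + k < M) :
    applyStr column.toPreGraph (wStr o k j) (intervalColumn (o + j) k M) =
      some (intervalColumn (o + j + 1) k M) := by
  have key : ∀ r ≤ k, applyStr column.toPreGraph
      ((List.range r).map fun m => o + j + k - 1 - m) (intervalColumn (o + j) k M) =
      some (fun x => decide (x = 0 ∨ (o + j ≤ x ∧ x ≤ o + j + k ∧ x ≠ o + j + k - r) ∨ x = M)) := by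
    intro r hr
    induction r with
    | zero =>
      refine congrArg some (funext fun x => ?_)
      simp only [intervalColumn]
      congr 1
      apply propext
      omega
    | succ r ih =>
      rw [List.range_succ, List.map_append]
      refine applyStr_append (ih (by omega)) ?_
      refine applyStr_cons_eq_some.2 ⟨_, column_F_iff.2 ⟨?_, rfl⟩, congrArg some ?_⟩
      · simp only [decide_eq_true_eq, decide_eq_false_iff_not]
        omega
      · funext x
        simp only [swapLetter]
        split_ifs <;> simp only [decide_eq_decide, false_or] <;> omega
  refine (key k le_rfl).trans (congrArg some (funext fun x => ?_))
  simp only [intervalColumn]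
  congr 1
  apply propext
  omega

theorem column_flatMap_wStr {o k M : ℕ} (r : ℕ) (hM : M = 0 ∨ o + r + k < M) :
    applyStr column.toPreGraph ((List.range r).flatMap fun jm => wStr o k (jm + 1))
      (intervalColumn (o + 1) k M) = some (intervalColumn (o + r + 1) k M) := by
  induction r with
  | zero => rfl
  | succ r ih =>
    rw [List.range_succ, List.flatMap_append, List.flatMap_singleton]
    exact applyStr_append (ih (by omega)) (column_wStr (by omega) (by omega))

theorem mem_wStr {o k j i : ℕ} (h : i ∈ wStr o k j) : o + j ≤ i ∧ i < o + j + k := by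
  simp only [wStr, List.mem_map, List.mem_range] at h
  omega

/-- The part of the `k`-th basic string of a lower subcrystal. -/
def lowerStr (n k : ℕ) : List ℕ := (List.range (n - k)).flatMap fun jm => wStr 1 k (jm + 1)

theorem mem_lowerStr {n k i : ℕ} (h : i ∈ lowerStr n k) : 2 ≤ i ∧ i ≤ n := by
  simp only [lowerStr, List.mem_flatMap, List.mem_range] at h
  obtain ⟨j, hj, h⟩ := h
  have := mem_wStr h
  omega

theorem mem_SStr {m k i : ℕ} (hk : k ≤ m) (h : i ∈ SStr 0 m k) : 1 ≤ i ∧ i ≤ m := by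
  simp only [SStr, List.mem_flatMap, List.mem_range] at h
  obtain ⟨j, hj, h⟩ := h
  have := mem_wStr h
  omega

/-- A vertex `p` that is a source with parameter `d` for the colors `I` and from which the
string `L` of colors in `I` leads to `q`. -/
structure Leads (X : ECrystal) (I : Set ℕ) (d : ℕ → ℕ) (L : List ℕ) (p q : X.V) : Prop where
  ep_eq : ∀ i ∈ I, X.ep i p = 0
  ph_eq : ∀ i ∈ I, X.ph i p = d i
  mem : ∀ i ∈ L, i ∈ I
  apply_eq : applyStr X.toPreGraph L p = some q

theorem Leads.tensor {I : Set ℕ} {d d' : ℕ → ℕ} {L L' : List ℕ} {p p' : X.V} {q q' : Y.V}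
    (hX : X.Forward C) (hI : I ⊆ C) (hp' : ∀ i ∈ I, X.ph i p' = 0)
    (h : X.Leads I d L p p') (h' : Y.Leads I d' L' q q') :
    (tensor X Y).Leads I (fun i => d i + d' i) (L ++ L') (p, q) (p', q') where
  ep_eq i hi := by simp [ECrystal.tensor, h.ep_eq i hi, h'.ep_eq i hi]
  ph_eq i hi := by simp [ECrystal.tensor, h.ph_eq i hi, h'.ep_eq i hi, h'.ph_eq i hi, add_comm]
  mem i hi := (List.mem_append.1 hi).elim (h.mem i) (h'.mem i)
  apply_eq := applyStr_append
    (tensor_applyStr_left hX (fun i hi => hI (h.mem i hi))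
      (fun i hi => h'.ep_eq i (h.mem i hi)) h.apply_eq)
    (tensor_applyStr_right (fun i hi => hp' i (h'.mem i hi)) h'.apply_eq)

theorem column_sink_ph {n k : ℕ} (hn : k ≤ n) (i : ℕ) (hi : i ∈ Set.Icc 1 n) :
    column.ph i (intervalColumn (n - k + 2) k 0) = 0 := by
  obtain ⟨h1, h2⟩ := hi
  refine if_neg ?_
  simp only [intervalColumn, decide_eq_true_eq, decide_eq_false_iff_not]
  omega

theorem column_leads {n k : ℕ} (hk : 1 ≤ k) (hn : k ≤ n) :
    column.Leads (Set.Icc 1 n) (fun i => if k = i then 1 else 0) (SStr 0 n k)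
      (intervalColumn 1 k 0) (intervalColumn (n - k + 2) k 0) where
  ep_eq i hi := by
    obtain ⟨h1, h2⟩ := hi
    refine if_neg ?_
    simp only [intervalColumn, decide_eq_true_eq, decide_eq_false_iff_not]
    omega
  ph_eq i hi := by
    obtain ⟨h1, h2⟩ := hi
    refine if_congr ?_ rfl rfl
    simp only [intervalColumn, decide_eq_true_eq, decide_eq_false_iff_not]
    omega
  mem i hi := mem_SStr hn hi
  apply_eq := (column_flatMap_wStr (o := 0) (n - k + 1) (Or.inl rfl)).trans
    (by congr 2; omega)

theorem column_leads_upper {n k : ℕ} (hk : 1 ≤ k) (hn : k ≤ n) :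
    column.Leads (Set.Icc 1 (n - 1)) (fun i => if k = i + 1 then 1 else 0) (SStr 0 (n - 1) (k - 1))
      (intervalColumn 1 (k - 1) (n + 1)) (intervalColumn (n - k + 2) k 0) where
  ep_eq i hi := by
    obtain ⟨h1, h2⟩ := hi
    refine if_neg ?_
    simp only [intervalColumn, decide_eq_true_eq, decide_eq_false_iff_not]
    omega
  ph_eq i hi := by
    obtain ⟨h1, h2⟩ := hi
    refine if_congr ?_ rfl rfl
    simp only [intervalColumn, decide_eq_true_eq, decide_eq_false_iff_not]
    omega
  mem i hi := mem_SStr (by omega) hi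
  apply_eq := by
    refine (column_flatMap_wStr (o := 0) _ (Or.inr (by omega))).trans
      (congrArg some (funext fun x => ?_))
    simp only [intervalColumn]
    congr 1
    apply propext
    omega

theorem column_leads_lower (n k : ℕ) :
    column.Leads (Set.Icc 2 n) (fun i => if k = i - 1 then 1 else 0) (lowerStr n k)
      (intervalColumn 2 k 0) (intervalColumn (n - k + 2) k 0) where
  ep_eq i hi := by
    obtain ⟨h1, h2⟩ := hi
    refine if_neg ?_
    simp only [intervalColumn, decide_eq_true_eq, decide_eq_false_iff_not]
    omega
  ph_eq i hi := by
    obtain ⟨h1, h2⟩ := hi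
    refine if_congr ?_ rfl rfl
    simp only [intervalColumn, decide_eq_true_eq, decide_eq_false_iff_not]
    omega
  mem i hi := mem_lowerStr hi
  apply_eq := (column_flatMap_wStr (o := 1) (n - k) (Or.inl rfl)).trans
    (by congr 2; omega)

/-- The one-vertex crystal. -/
def point : ECrystal where
  V := Unit
  F _ _ := none
  E _ _ := none
  ep _ _ := 0
  ph _ _ := 0

theorem point_regular (C : Set ℕ) : point.Regular C := by
  constructor <;> constructor <;> simp [point, dual]

theorem exists_column_model (n : ℕ) (ks : List ℕ) (hks : ∀ k ∈ ks, 1 ≤ k ∧ k ≤ n) :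
    ∃ (X : ECrystal) (x y u l : X.V), X.Regular (Set.Icc 1 n) ∧
      (∀ i ∈ Set.Icc 1 n, X.ph i y = 0) ∧
      X.Leads (Set.Icc 1 n) (fun i => ks.count i) (ks.flatMap (SStr 0 n)) x y ∧
      X.Leads (Set.Icc 1 (n - 1)) (fun i => ks.count (i + 1))
        (ks.flatMap fun k => SStr 0 (n - 1) (k - 1)) u y ∧
      X.Leads (Set.Icc 2 n) (fun i => ks.count (i - 1)) (ks.flatMap (lowerStr n)) l y := by
  induction ks with
  | nil =>
    exact ⟨point, (), (), (), (), point_regular _, fun _ _ => rfl,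
      ⟨fun _ _ => rfl, fun _ _ => rfl, by simp, rfl⟩,
      ⟨fun _ _ => rfl, fun _ _ => rfl, by simp, rfl⟩,
      ⟨fun _ _ => rfl, fun _ _ => rfl, by simp, rfl⟩⟩
  | cons k ks ih =>
    obtain ⟨X, x, y, u, l, hX, hy, hx, hu, hl⟩ := ih fun k hk => hks k (List.mem_cons_of_mem _ hk)
    obtain ⟨hk, hkn⟩ := hks k List.mem_cons_self
    have hcount : ∀ i, (k :: ks).count i = (if k = i then 1 else 0) + ks.count i := by
      intro i
      rw [List.count_cons, add_comm]
      simp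
    have hup : Set.Icc 1 (n - 1) ⊆ Set.Icc 1 n := Set.Icc_subset_Icc le_rfl (Nat.sub_le _ _)
    have hlow : Set.Icc 2 n ⊆ Set.Icc 1 n := Set.Icc_subset_Icc one_le_two le_rfl
    have hsink := column_sink_ph hkn
    refine ⟨tensor column X, (intervalColumn 1 k 0, x), (intervalColumn (n - k + 2) k 0, y),
      (intervalColumn 1 (k - 1) (n + 1), u), (intervalColumn 2 k 0, l),
      (column_regular _).tensor hX, ?_, ?_, ?_, ?_⟩
    · intro i hi
      change X.ph i y + (column.ph i _ - _) = 0
      rw [hy i hi, hsink i hi, Nat.zero_sub]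
    · simp only [hcount]
      exact (column_leads hk hkn).tensor (column_forward _) subset_rfl hsink hx
    · simp only [hcount]
      exact (column_leads_upper hk hkn).tensor (column_forward _) hup
        (fun i hi => hsink i (hup hi)) hu
    · simp only [hcount]
      exact (column_leads_lower n k).tensor (column_forward _) hlow
        (fun i hi => hsink i (hlow hi)) hl

/-- The list of column heights with `a k` columns of height `k`, for `1 ≤ k ≤ n`. -/
def heights (n : ℕ) (a : ℕ → ℕ) : List ℕ :=
  (List.range n).flatMap fun km => List.replicate (a (km + 1)) (km + 1)

theorem mem_heights {n k : ℕ} {a : ℕ → ℕ} (h : k ∈ heights n a) : 1 ≤ k ∧ k ≤ n := by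
  simp only [heights, List.mem_flatMap, List.mem_range, List.mem_replicate] at h
  omega

theorem count_heights (n : ℕ) (a : ℕ → ℕ) (i : ℕ) :
    (heights n a).count i = if 1 ≤ i ∧ i ≤ n then a i else 0 := by
  induction n with
  | zero =>
    rw [if_neg (by omega)]
    rfl
  | succ n ih =>
    have : heights (n + 1) a = heights n a ++ List.replicate (a (n + 1)) (n + 1) := by
      simp [heights, List.range_succ]
    rw [this, List.count_append, ih, List.count_replicate]
    by_cases hi : i = n + 1
    · subst hi
      simp
    · have : ¬ n + 1 = i := fun h => hi h.symm
      have h' : 1 ≤ i ∧ i ≤ n + 1 ↔ 1 ≤ i ∧ i ≤ n := by omega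
      simp [this, h']

theorem flatMap_heights (n : ℕ) (a : ℕ → ℕ) (f : ℕ → List ℕ) : (heights n a).flatMap f =
    (List.range n).flatMap fun km => (List.replicate (a (km + 1)) (f (km + 1))).flatten := by
  rw [heights, List.flatMap_assoc]
  simp only [List.flatMap_replicate]

theorem prinStr_eq_flatMap_heights (n : ℕ) (a : ℕ → ℕ) :
    prinStr 0 n a = (heights n a).flatMap (SStr 0 n) := by
  simp [flatMap_heights, prinStr]

theorem prinStr_upper_eq_flatMap_heights (n : ℕ) (a : ℕ → ℕ) :
    prinStr 0 (n - 1) (fun i => a (i + 1)) =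
      (heights n a).flatMap fun k => SStr 0 (n - 1) (k - 1) := by
  rw [flatMap_heights]
  cases n with
  | zero => rfl
  | succ m =>
    have h0 : SStr 0 m 0 = [] := by simp [SStr, wStr]
    simp [prinStr, List.range_succ_eq_map, List.flatMap_map, h0]

theorem prinStr_lower_eq_flatMap_heights (n : ℕ) (b : ℕ → ℕ) :
    prinStr 1 (n - 1) (fun i => b (i - 1)) = (heights n b).flatMap (lowerStr n) := by
  rw [flatMap_heights]
  cases n with
  | zero => rfl
  | succ m =>
    have h0 : lowerStr (m + 1) (m + 1) = [] := by simp [lowerStr]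
    rw [List.range_succ, List.flatMap_append, List.flatMap_singleton, h0]
    simp only [prinStr, Nat.add_sub_cancel, List.flatten_replicate_nil, List.append_nil]
    refine List.flatMap_congr fun k hk => ?_
    have hk := List.mem_range.1 hk
    rw [SStr, lowerStr, add_comm 1 k,
      show m - (k + 1) + 1 = m + 1 - (k + 1) by omega]

/-- A crystal with a source `x` of parameter `a + d` whose principal vertex `y` with
coordinates `a` is also reached by principal strings from the sources `u` and `l` of the
upper and lower subcrystals through `y`. -/
theorem exists_principal_model (n : ℕ) (a d : ℕ → ℕ) :
    ∃ (X : ECrystal) (x y u l : X.V), X.Regular (Set.Icc 1 n) ∧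
      X.Leads (Set.Icc 1 n) (fun i => a i + d i) (prinStr 0 n a) x y ∧
      X.Leads (Set.Icc 1 (n - 1)) (fun i => a (i + 1) + d i)
        (prinStr 0 (n - 1) (fun i => a (i + 1))) u y ∧
      X.Leads (Set.Icc 2 n) (fun i => a (i - 1) + d i)
        (prinStr 1 (n - 1) (fun i => a (i - 1))) l y := by
  obtain ⟨X, x, y, u, l, hX, hy, hx, hu, hl⟩ :=
    exists_column_model n (heights n a) fun _ => mem_heights
  obtain ⟨Z, z, _, _, _, hZ, _, hz, _, _⟩ :=
    exists_column_model n (heights n d) fun _ => mem_heights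
  have hup : Set.Icc 1 (n - 1) ⊆ Set.Icc 1 n := Set.Icc_subset_Icc le_rfl (Nat.sub_le _ _)
  have hlow : Set.Icc 2 n ⊆ Set.Icc 1 n := Set.Icc_subset_Icc one_le_two le_rfl
  have hz' : ∀ I ⊆ Set.Icc 1 n, Z.Leads I d [] z z := fun I hI =>
    ⟨fun i hi => hz.ep_eq i (hI hi),
      fun i hi => (hz.ph_eq i (hI hi)).trans ((count_heights n d i).trans (if_pos (hI hi))),
      fun _ h => absurd h List.not_mem_nil, rfl⟩
  have main : ∀ {I : Set ℕ} (_ : I ⊆ Set.Icc 1 n) {e e' : ℕ → ℕ} {L : List ℕ} {p : X.V},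
      X.Leads I e L p y → (∀ i ∈ I, e i = e' i) →
      (tensor X Z).Leads I (fun i => e' i + d i) L (p, z) (y, z) := by
    intro I hI e e' L p h he
    have := Leads.tensor hX.1 hI (fun i hi => hy i (hI hi))
      { h with ph_eq := fun i hi => (h.ph_eq i hi).trans (he i hi) } (hz' I hI)
    rwa [List.append_nil] at this
  rw [prinStr_eq_flatMap_heights, prinStr_upper_eq_flatMap_heights,
    prinStr_lower_eq_flatMap_heights]
  refine ⟨tensor X Z, (x, z), (y, z), (u, z), (l, z), hX.tensor hZ, main subset_rfl hx ?_,
    main hup hu ?_, main hlow hl ?_⟩ <;> rintro i ⟨h1, h2⟩ <;>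
    exact (count_heights n a _).trans (if_pos (by omega))

end ECrystal

theorem optIter_succ_eq_bind {V : Type} (f : V → Option V) (k : ℕ) (v : V) :
    optIter f (k + 1) v = (optIter f k v).bind f := by
  induction k generalizing v with
  | zero => exact Option.bind_fun_some (f v)
  | succ k ih =>
    change (f v).bind (optIter f (k + 1)) = ((f v).bind (optIter f k)).bind f
    rw [Option.bind_assoc]
    exact congrArg _ (funext ih)

theorem optIter_eq_of_add {V : Type} {f : V → Option V} {k l : ℕ} {u v : V}
    (h : optIter f k u = some v) : optIter f (k + l) u = optIter f l v := by
  induction k generalizing u with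
  | zero =>
    obtain rfl : u = v := Option.some.inj h
    rw [Nat.zero_add]
  | succ k ih =>
    obtain ⟨w, hw, h⟩ := Option.bind_eq_some_iff.1 h
    rw [Nat.succ_add]
    change (f u).bind _ = _
    rw [hw]
    exact ih h

theorem optIter_isSome_of_le {V : Type} {f : V → Option V} {k l : ℕ} {v : V} (hkl : k ≤ l)
    (h : (optIter f l v).isSome = true) : (optIter f k v).isSome = true := by
  induction hkl with
  | refl => exact h
  | step _ ih =>
    refine ih ?_
    rw [optIter_succ_eq_bind] at h
    exact Option.isSome_of_isSome_bind h

namespace IsColored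

variable {K : PreGraph} {C : Set ℕ}

theorem Finv_eq_some_iff (hK : IsColored K C) {i : ℕ} {u v : K.V} :
    K.Finv i v = some u ↔ K.F i u = some v := by
  unfold PreGraph.Finv
  split_ifs with h
  · rw [Option.some_inj]
    exact ⟨fun e => e ▸ h.choose_spec, fun hu => hK.2.2.1 i _ _ _ h.choose_spec hu⟩
  · exact ⟨fun e => absurd e (by simp), fun hu => absurd ⟨u, hu⟩ h⟩

theorem lt_card_of_optIter (hK : IsColored K C) {i k : ℕ} {v : K.V}
    (h : (optIter (K.F i) k v).isSome = true) :
    k < Nat.card K.V := by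
  have := hK.1
  have hs : ∀ m : Fin (k + 1), (optIter (K.F i) m v).isSome = true := fun m =>
    optIter_isSome_of_le (Nat.lt_succ_iff.1 m.2) h
  have hlt : ∀ m m' : Fin (k + 1), m < m' →
      (optIter (K.F i) m v).get (hs m) ≠ (optIter (K.F i) m' v).get (hs m') := by
    intro m m' hm he
    refine hK.2.2.2 i ((optIter (K.F i) m v).get (hs m)) (m' - m) (Nat.sub_pos_of_lt hm) ?_
    rw [← optIter_eq_of_add (Option.some_get (hs m)).symm, Nat.add_sub_cancel' (le_of_lt hm), he,
      Option.some_get]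
  have hinj : Function.Injective fun m : Fin (k + 1) => (optIter (K.F i) m v).get (hs m) := by
    intro m m' he
    rcases lt_trichotomy m m' with hm | hm | hm
    · exact absurd he (hlt m m' hm)
    · exact hm
    · exact absurd he.symm (hlt m' m hm)
  have := Nat.card_le_card_of_injective _ hinj
  rw [Nat.card_eq_fintype_card, Fintype.card_fin] at this
  exact this

theorem optIter_isSome_iff (hK : IsColored K C) {i k : ℕ} {v : K.V} :
    (optIter (K.F i) k v).isSome = true ↔ k ≤ K.h i v := by
  have hb : BddAbove {k | (optIter (K.F i) k v).isSome = true} :=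
    ⟨Nat.card K.V, fun k hk => (hK.lt_card_of_optIter hk).le⟩
  refine ⟨fun h => le_csSup hb h, fun h => optIter_isSome_of_le h ?_⟩
  exact Nat.sSup_mem ⟨0, show (optIter _ 0 v).isSome = true from rfl⟩ hb

theorem exists_optIter_iff (hK : IsColored K C) {i k : ℕ} {v : K.V} :
    (∃ u, optIter (K.F i) k u = some v) ↔ k ≤ K.t i v := by
  have hb : BddAbove {k | ∃ u, optIter (K.F i) k u = some v} :=
    ⟨Nat.card K.V, fun k ⟨u, hu⟩ => (hK.lt_card_of_optIter (by rw [hu]; rfl)).le⟩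
  refine ⟨fun h => le_csSup hb h, fun h => ?_⟩
  obtain ⟨l, hl⟩ := Nat.exists_eq_add_of_le' h
  obtain ⟨u, hu⟩ : ∃ u, optIter (K.F i) (K.t i v) u = some v :=
    Nat.sSup_mem (s := {k | ∃ u, optIter (K.F i) k u = some v}) ⟨0, v, rfl⟩ hb
  rw [hl] at hu
  obtain ⟨w, hw⟩ := Option.isSome_iff_exists.1
    (optIter_isSome_of_le (Nat.le_add_right l k) (by rw [hu]; rfl))
  exact ⟨w, (optIter_eq_of_add hw).symm.trans hu⟩

theorem h_pos_iff (hK : IsColored K C) {i : ℕ} {u : K.V} : 0 < K.h i u ↔ ∃ v, K.F i u = some v := by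
  rw [Nat.lt_iff_add_one_le, ← hK.optIter_isSome_iff, Option.isSome_iff_exists,
    optIter_succ_eq_bind]
  rfl

theorem t_pos_iff (hK : IsColored K C) {i : ℕ} {v : K.V} : 0 < K.t i v ↔ ∃ u, K.F i u = some v := by
  rw [Nat.lt_iff_add_one_le, ← hK.exists_optIter_iff]
  simp only [optIter_succ_eq_bind]
  rfl

theorem h_eq_of_edge (hK : IsColored K C) {i : ℕ} {u v : K.V}
    (h : K.F i u = some v) : K.h i u = K.h i v + 1 := by
  have key : ∀ k, k + 1 ≤ K.h i u ↔ k ≤ K.h i v := by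
    intro k
    rw [← hK.optIter_isSome_iff, ← hK.optIter_isSome_iff]
    change ((K.F i u).bind _).isSome = true ↔ _
    rw [h]
    rfl
  have h1 := key (K.h i v)
  have h2 := key (K.h i v + 1)
  omega

theorem t_eq_of_edge (hK : IsColored K C) {i : ℕ} {u v : K.V}
    (h : K.F i u = some v) : K.t i v = K.t i u + 1 := by
  have key : ∀ k, k + 1 ≤ K.t i v ↔ k ≤ K.t i u := by
    intro k
    rw [← hK.exists_optIter_iff, ← hK.exists_optIter_iff]
    refine exists_congr fun w => ?_
    rw [optIter_succ_eq_bind, Option.bind_eq_some_iff]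
    refine ⟨?_, fun hw => ⟨u, hw, h⟩⟩
    rintro ⟨x, hx, hx'⟩
    rwa [hK.2.2.1 i _ _ _ h hx']
  have h1 := key (K.t i u)
  have h2 := key (K.t i u + 1)
  omega

end IsColored

/-- A colored graph with its inverse operators and string lengths. -/
noncomputable def PreGraph.toECrystal (K : PreGraph) : ECrystal where
  toPreGraph := K
  E := K.Finv
  ep := K.t
  ph := K.h

namespace IsCrystalOn

variable {K : PreGraph} {C : Set ℕ}

theorem near (hK : IsCrystalOn K C) {i j : ℕ} (hi : i ∈ C) (hj : j ∈ C) (hij : Neighb i j)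
    {u v : K.V} (h : K.F i u = some v) : (K.h j v = K.h j u ∧ K.t j u = K.t j v + 1) ∨
      (K.h j v = K.h j u + 1 ∧ K.t j v = K.t j u) := by
  have hne : i ≠ j := by unfold Neighb at hij; omega
  obtain ⟨h1, h2, h3⟩ := (hK.2.2.1 i hi j hj hne).1 u v h
  rw [if_pos hij] at h3
  omega

theorem far (hK : IsCrystalOn K C) {i j : ℕ} (hi : i ∈ C) (hj : j ∈ C) (hij : Far i j)
    {u v : K.V} (h : K.F i u = some v) : K.h j v = K.h j u ∧ K.t j v = K.t j u := by
  have hne : i ≠ j := by unfold Far at hij; omega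
  have hn : ¬ Neighb i j := by unfold Far at hij; unfold Neighb; omega
  obtain ⟨h1, h2, h3⟩ := (hK.2.2.1 i hi j hj hne).1 u v h
  rw [if_neg hn] at h3
  omega

theorem forward (hK : IsCrystalOn K C) : K.toECrystal.Forward C where
  inv i _ u v := hK.1.Finv_eq_some_iff.symm
  pos i _ u := hK.1.h_pos_iff
  step i _ u v h := ⟨hK.1.h_eq_of_edge h, hK.1.t_eq_of_edge h⟩
  near i hi j hj hij u v h := hK.near hi hj hij h
  far i hi j hj hij u v h := hK.far hi hj hij h
  far_comm i hi j hj hij u v v' h h' := by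
    change K.F i u = some v at h
    change K.F j u = some v' at h'
    have := hK.2.2.2.2 i hi j hj hij (K.F i) (Or.inl rfl) (K.F j) (Or.inl rfl) u
      (by rw [h]; rfl) (by rw [h']; rfl)
    rwa [h, h'] at this
  near_comm i hi j hj hij u v v' h h' hl := by
    obtain ⟨h1, h2⟩ := (hK.2.2.2.1 i hi j hj hij).1.1 u v v' h h' hl
    refine ⟨?_, h2⟩
    change K.h i v' = K.h i u + 1
    omega
  verma i hi j hj hij u v v' h h' hl hl' := by
    change K.F i u = some v at h
    change K.F j u = some v' at h'
    change K.h j v = K.h j u + 1 at hl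
    change K.h i v' = K.h i u + 1 at hl'
    obtain ⟨w, h1, h2⟩ := (hK.2.2.2.1 i hi j hj hij).2.1 u v v' h h' (by omega) (by omega)
    simp only [h, h', Option.bind_eq_some_iff] at h1 h2
    obtain ⟨q, ⟨p, hp, hq⟩, hw⟩ := h1
    obtain ⟨q', ⟨p', hp', hq'⟩, hw'⟩ := h2
    exact ⟨p, q, p', q', w, hp, hq, hw, hp', hq', hw'⟩

theorem dual_forward (hK : IsCrystalOn K C) : K.toECrystal.dual.Forward C where
  inv i _ u v := hK.1.Finv_eq_some_iff
  pos i _ u := hK.1.t_pos_iff.trans (exists_congr fun _ => hK.1.Finv_eq_some_iff.symm)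
  step i _ u v h :=
    have h := hK.1.Finv_eq_some_iff.1 h
    ⟨hK.1.t_eq_of_edge h, hK.1.h_eq_of_edge h⟩
  near i hi j hj hij u v h := by
    have := hK.near hi hj hij (hK.1.Finv_eq_some_iff.1 h)
    change (K.t j v = K.t j u ∧ K.h j u = K.h j v + 1) ∨ (K.t j v = K.t j u + 1 ∧ K.h j v = K.h j u)
    omega
  far i hi j hj hij u v h :=
    have := hK.far hi hj hij (hK.1.Finv_eq_some_iff.1 h)
    ⟨this.2.symm, this.1.symm⟩
  far_comm i hi j hj hij u v v' h h' := by
    change K.Finv i u = some v at h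
    change K.Finv j u = some v' at h'
    have := hK.2.2.2.2 i hi j hj hij (K.Finv i) (Or.inr rfl) (K.Finv j) (Or.inr rfl) u
      (by rw [h]; rfl) (by rw [h']; rfl)
    rwa [h, h'] at this
  near_comm i hi j hj hij u v v' h h' hl := by
    have hF := hK.1.Finv_eq_some_iff.1 h
    have hF' := hK.1.Finv_eq_some_iff.1 h'
    change K.t j v = K.t j u at hl
    have h1 := hK.near hi hj hij hF
    have h2 := hK.near hj hi hij.symm hF'
    obtain ⟨h3, w, hw, hw'⟩ := (hK.2.2.2.1 i hi j hj hij).1.2 v v' u hF hF' (by omega)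
    refine ⟨?_, w, hK.1.Finv_eq_some_iff.2 hw, hK.1.Finv_eq_some_iff.2 hw'⟩
    change K.t i v' = K.t i u + 1
    omega
  verma i hi j hj hij u v v' h h' hl hl' := by
    have hF := hK.1.Finv_eq_some_iff.1 h
    have hF' := hK.1.Finv_eq_some_iff.1 h'
    change K.Finv i u = some v at h
    change K.Finv j u = some v' at h'
    change K.t j v = K.t j u + 1 at hl
    change K.t i v' = K.t i u + 1 at hl'
    have h1 := hK.near hi hj hij hF
    have h2 := hK.near hj hi hij.symm hF'
    obtain ⟨w, h3, h4⟩ := (hK.2.2.2.1 i hi j hj hij).2.2 v v' u hF hF' (by omega) (by omega)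
    simp only [h, h', Option.bind_eq_some_iff] at h3 h4
    obtain ⟨q, ⟨p, hp, hq⟩, hw⟩ := h3
    obtain ⟨q', ⟨p', hp', hq'⟩, hw'⟩ := h4
    exact ⟨p, q, p', q', w, hp, hq, hw, hp', hq', hw'⟩

theorem regular (hK : IsCrystalOn K C) : K.toECrystal.Regular C :=
  ⟨hK.forward, hK.dual_forward⟩

end IsCrystalOn

theorem Option.exists_of_map_val_eq {V : Type} {p : V → Prop} {o o' : Option {x // p x}}
    (h : ∃ w, o.map Subtype.val = some w ∧ o'.map Subtype.val = some w) :
    ∃ w, o = some w ∧ o' = some w := by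
  obtain ⟨w, h, h'⟩ := h
  obtain ⟨x, hx, rfl⟩ := Option.map_eq_some_iff.1 h
  obtain ⟨x', hx', he⟩ := Option.map_eq_some_iff.1 h'
  exact ⟨x, hx, hx'.trans (congrArg some (Subtype.ext he))⟩

theorem Option.isSome_eq_of_map_val {V : Type} {p : V → Prop} {o : Option {x // p x}}
    {o' : Option V} (h : o.map Subtype.val = o') : o.isSome = o'.isSome := by
  rw [← h, Option.isSome_map]

theorem Option.map_val_bind {V : Type} {p : V → Prop} {o : Option {x // p x}} {o' : Option V}
    {f : {x // p x} → Option {x // p x}} {g : V → Option V} (h : o.map Subtype.val = o')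
    (hfg : ∀ x, (f x).map Subtype.val = g x.1) : (o.bind f).map Subtype.val = o'.bind g := by
  subst h
  cases o with
  | none => rfl
  | some x => exact hfg x

namespace PreGraph

variable {K : PreGraph} {C I : Set ℕ} {v₀ : K.V}

theorem sub_F_iff {i : ℕ} {x y : (K.sub I v₀).V} :
    (K.sub I v₀).F i x = some y ↔ i ∈ I ∧ K.F i x.1 = some y.1 := by
  by_cases hi : i ∈ I
  · refine (Eq.congr_left (dif_pos hi)).trans (Option.pbind_eq_some_iff.trans ⟨?_, fun h => ?_⟩)
    · rintro ⟨w, hw, h⟩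
      obtain rfl := Option.some.inj h
      exact ⟨hi, hw⟩
    · exact ⟨y.1, h.2, rfl⟩
  · exact ⟨fun h => absurd ((dif_neg hi).symm.trans h) (by simp), fun h => absurd h.1 hi⟩

theorem sub_F_map {i : ℕ} (hi : i ∈ I) (x : (K.sub I v₀).V) :
    ((K.sub I v₀).F i x).map Subtype.val = K.F i x.1 := by
  ext w
  refine Option.map_eq_some_iff.trans ⟨?_, fun h => ?_⟩
  · rintro ⟨y, hy, rfl⟩
    exact (sub_F_iff.1 hy).2
  · exact ⟨⟨w, x.2.tail ⟨i, hi, Or.inl h⟩⟩, sub_F_iff.2 ⟨hi, h⟩, rfl⟩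

theorem exists_sub_edge_to {i : ℕ} (hi : i ∈ I) {u : K.V} {x : (K.sub I v₀).V}
    (h : K.F i u = some x.1) : ∃ y : (K.sub I v₀).V, y.1 = u ∧ (K.sub I v₀).F i y = some x :=
  ⟨⟨u, x.2.tail ⟨i, hi, Or.inr h⟩⟩, rfl, sub_F_iff.2 ⟨hi, h⟩⟩

theorem sub_optIter_map {i : ℕ} (hi : i ∈ I) (k : ℕ) (x : (K.sub I v₀).V) :
    (optIter ((K.sub I v₀).F i) k x).map Subtype.val = optIter (K.F i) k x.1 := by
  induction k generalizing x with
  | zero => rfl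
  | succ k ih => exact Option.map_val_bind (sub_F_map hi x) ih

theorem sub_h {i : ℕ} (hi : i ∈ I) (x : (K.sub I v₀).V) : (K.sub I v₀).h i x = K.h i x.1 := by
  unfold h
  congr 1
  ext k
  exact Eq.congr_left (Option.isSome_eq_of_map_val (sub_optIter_map hi k x))

theorem exists_sub_optIter_to {i : ℕ} (hi : i ∈ I) {k : ℕ} {u : K.V} {x : (K.sub I v₀).V}
    (h : optIter (K.F i) k u = some x.1) : ∃ y, optIter ((K.sub I v₀).F i) k y = some x := by
  induction k generalizing x with
  | zero => exact ⟨x, rfl⟩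
  | succ k ih =>
    rw [optIter_succ_eq_bind, Option.bind_eq_some_iff] at h
    obtain ⟨w, hw, h⟩ := h
    obtain ⟨y, rfl, hy⟩ := exists_sub_edge_to hi h
    obtain ⟨z, hz⟩ := ih hw
    refine ⟨z, ?_⟩
    rw [optIter_succ_eq_bind, hz]
    exact hy

theorem sub_t {i : ℕ} (hi : i ∈ I) (x : (K.sub I v₀).V) : (K.sub I v₀).t i x = K.t i x.1 := by
  unfold t
  congr 1
  ext k
  refine ⟨?_, fun ⟨u, hu⟩ => exists_sub_optIter_to hi hu⟩
  rintro ⟨y, hy⟩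
  exact ⟨y.1, (sub_optIter_map hi k y).symm.trans (by rw [hy]; rfl)⟩

theorem sub_connected : (K.sub I v₀).Connected := by
  have : Std.Symm (K.sub I v₀).Step := ⟨fun _ _ ⟨i, h⟩ => ⟨i, h.symm⟩⟩
  have key : ∀ u (hu : inComp K I v₀ u), Relation.ReflTransGen (K.sub I v₀).Step
      ⟨v₀, Relation.ReflTransGen.refl⟩ ⟨u, hu⟩ := by
    intro u hu
    induction hu with
    | refl => exact .refl
    | tail h hs ih =>
      obtain ⟨i, hi, hs⟩ := hs
      exact ih.tail ⟨i, hs.imp (fun h => sub_F_iff.2 ⟨hi, h⟩) (fun h => sub_F_iff.2 ⟨hi, h⟩)⟩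
  exact fun u v => (Relation.ReflTransGen.stdSymm.symm _ _ (key u.1 u.2)).trans (key v.1 v.2)

theorem sub_isColored (hK : IsColored K C) : IsColored (K.sub I v₀) I := by
  refine ⟨?_, fun i hi v => dif_neg hi, ?_, ?_⟩
  · have := hK.1
    exact Subtype.finite
  · intro i u u' v h h'
    exact Subtype.ext (hK.2.2.1 i _ _ _ (sub_F_iff.1 h).2 (sub_F_iff.1 h').2)
  · intro i v k hk h
    obtain ⟨k, rfl⟩ := Nat.exists_eq_add_one_of_ne_zero hk.ne'
    have hi : i ∈ I := by
      obtain ⟨w, hw, -⟩ := Option.bind_eq_some_iff.1 h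
      exact (sub_F_iff.1 hw).1
    refine hK.2.2.2 i v.1 (k + 1) hk ((sub_optIter_map hi _ v).symm.trans ?_)
    rw [h]
    rfl

theorem sub_Finv_map (hK : IsColored K C) {i : ℕ} (hi : i ∈ I) (x : (K.sub I v₀).V) :
    ((K.sub I v₀).Finv i x).map Subtype.val = K.Finv i x.1 := by
  ext w
  rw [hK.Finv_eq_some_iff]
  refine Option.map_eq_some_iff.trans ⟨?_, fun h => ?_⟩
  · rintro ⟨y, hy, rfl⟩
    exact (sub_F_iff.1 ((sub_isColored hK).Finv_eq_some_iff.1 hy)).2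
  · obtain ⟨y, rfl, hy⟩ := exists_sub_edge_to hi h
    exact ⟨y, (sub_isColored hK).Finv_eq_some_iff.2 hy, rfl⟩

theorem sub_isCrystalOn (hK : IsCrystalOn K C) (hI : I ⊆ C) : IsCrystalOn (K.sub I v₀) I := by
  have val : ∀ {i u v}, (K.sub I v₀).F i u = some v → K.F i u.1 = some v.1 :=
    fun h => (sub_F_iff.1 h).2
  refine ⟨sub_isColored hK.1, sub_connected, ?_, ?_, ?_⟩
  · intro i hi j hj hij
    refine ⟨fun u v h => ?_, fun u v w h h' => ?_⟩
    · simp only [sub_h hj, sub_t hj]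
      exact (hK.2.2.1 i (hI hi) j (hI hj) hij).1 _ _ (val h)
    · simp only [sub_h hj]
      exact (hK.2.2.1 i (hI hi) j (hI hj) hij).2 _ _ _ (val h) (val h')
  · intro i hi j hj hij
    obtain ⟨⟨h3, h3'⟩, h4, h4'⟩ := hK.2.2.2.1 i (hI hi) j (hI hj) hij
    refine ⟨⟨fun u v v' h h' hl => ?_, fun u u' v h h' hl => ?_⟩,
      fun u v v' h h' hl hl' => ?_, fun u u' v h h' hl hl' => ?_⟩ <;>
      simp only [sub_h hi, sub_h hj] at *
    · obtain ⟨h1, h2⟩ := h3 _ _ _ (val h) (val h') hl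
      refine ⟨h1, Option.exists_of_map_val_eq ?_⟩
      rwa [sub_F_map hj, sub_F_map hi]
    · obtain ⟨h1, w, hw, hw'⟩ := h3' _ _ _ (val h) (val h') hl
      obtain ⟨y, rfl, hy⟩ := exists_sub_edge_to hj hw
      exact ⟨h1, y, hy, sub_F_iff.2 ⟨hi, hw'⟩⟩
    · obtain ⟨w, hw, hw'⟩ := h4 _ _ _ (val h) (val h') hl hl'
      have fi := sub_F_map (K := K) (v₀ := v₀) hi
      have fj := sub_F_map (K := K) (v₀ := v₀) hj
      exact Option.exists_of_map_val_eq ⟨w,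
        (Option.map_val_bind (Option.map_val_bind (Option.map_val_bind (fi u) fj) fj) fi).trans hw,
        (Option.map_val_bind (Option.map_val_bind (Option.map_val_bind (fj u) fi) fi) fj).trans hw'⟩
    · obtain ⟨w, hw, hw'⟩ := h4' _ _ _ (val h) (val h') hl hl'
      have fi := sub_Finv_map (v₀ := v₀) hK.1 hi
      have fj := sub_Finv_map (v₀ := v₀) hK.1 hj
      exact Option.exists_of_map_val_eq ⟨w,
        (Option.map_val_bind (Option.map_val_bind (Option.map_val_bind (fi v) fj) fj) fi).trans hw,
        (Option.map_val_bind (Option.map_val_bind (Option.map_val_bind (fj v) fi) fi) fj).trans hw'⟩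
  · intro i hi j hj hij Fi hFi Fj hFj v hv hv'
    have key : ∀ k ∈ I, ∀ f ∈ ({(K.sub I v₀).F k, (K.sub I v₀).Finv k} : Set _),
        ∃ g ∈ ({K.F k, K.Finv k} : Set (K.V → Option K.V)),
          ∀ x, (f x).map Subtype.val = g x.1 := by
      rintro k hk f (rfl | rfl)
      · exact ⟨_, Or.inl rfl, sub_F_map hk⟩
      · exact ⟨_, Or.inr rfl, sub_Finv_map hK.1 hk⟩
    obtain ⟨Gi, hGi, hi'⟩ := key i hi Fi hFi
    obtain ⟨Gj, hGj, hj'⟩ := key j hj Fj hFj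
    obtain ⟨w, hw, hw'⟩ := hK.2.2.2.2 i (hI hi) j (hI hj) hij Gi hGi Gj hGj v.1
      ((Option.isSome_eq_of_map_val (hi' v)).symm.trans hv)
      ((Option.isSome_eq_of_map_val (hj' v)).symm.trans hv')
    exact Option.exists_of_map_val_eq ⟨w, (Option.map_val_bind (hi' v) hj').trans hw,
      (Option.map_val_bind (hj' v) hi').trans hw'⟩

theorem exists_sub_applyStr_to {L : List ℕ} (hL : ∀ i ∈ L, i ∈ I) {u : K.V}
    {x : (K.sub I v₀).V} (h : applyStr K L u = some x.1) :
    ∃ y : (K.sub I v₀).V, y.1 = u ∧ applyStr (K.sub I v₀) L y = some x := by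
  induction L generalizing u with
  | nil => exact ⟨x, (Option.some.inj h).symm, rfl⟩
  | cons i L ih =>
    obtain ⟨w, hw, h⟩ := ECrystal.applyStr_cons_eq_some.1 h
    obtain ⟨z, rfl, hz⟩ := ih (fun j hj => hL j (List.mem_cons_of_mem _ hj)) h
    obtain ⟨y, rfl, hy⟩ := exists_sub_edge_to (hL i List.mem_cons_self) hw
    exact ⟨y, rfl, ECrystal.applyStr_cons_eq_some.2 ⟨z, hy, hz⟩⟩

end PreGraph

/-- A vertex of a crystal `K` that is reached from the source as in a model `X` has its
`I`-colored component described by `X`. -/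
theorem IsCrystalOn.exists_sub_source {K : PreGraph} {C I : Set ℕ} (hK : IsCrystalOn K C)
    (hI : I ⊆ C) {s p : K.V} (hs : IsSource K s) {X : ECrystal} (hX : X.Regular C)
    {d d' : ℕ → ℕ} {L L' : List ℕ} {x y u : X.V} (hx : X.Leads C d L x y)
    (hu : X.Leads I d' L' u y) (hd : ∀ i ∈ C, K.h i s = d i) (hp : applyStr K L s = some p) :
    ∃ s' : (K.sub I p).V, IsSource (K.sub I p) s' ∧ (∀ i ∈ I, (K.sub I p).h i s' = d' i) ∧
      applyStr (K.sub I p) L' s' = some ⟨p, Relation.ReflTransGen.refl⟩ := by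
  have hlift := hK.regular.liftable hX (x₀ := s) (y₀ := x)
    (fun i _ => Nat.eq_zero_of_not_pos fun h0 =>
      let ⟨v, hv⟩ := hK.1.t_pos_iff.1 h0; hs i v hv)
    hx.ep_eq (fun i hi => (hd i hi).trans (hx.ph_eq i hi).symm)
  obtain ⟨r, hr⟩ := ECrystal.Track.applyStr (X := K.toECrystal) (x₀ := s) (y₀ := x)
    hx.mem .refl hp hx.apply_eq
  obtain ⟨r', s', hr', hs'⟩ := hr.pull_back hK.regular hX (fun r => (hlift r).2)
    (fun i hi => hI (hu.mem i hi)) hu.apply_eq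
  obtain ⟨z, rfl, hz⟩ := PreGraph.exists_sub_applyStr_to (v₀ := p)
    (x := ⟨p, Relation.ReflTransGen.refl⟩) hu.mem hs'
  have hstat := fun i (hi : i ∈ I) => (hlift r').1 _ _ hr' i (hI hi)
  refine ⟨z, fun i v hv => ?_, fun i hi => ?_, hz⟩
  · obtain ⟨hi, hv⟩ := PreGraph.sub_F_iff.1 hv
    have h0 := hK.1.t_pos_iff.2 ⟨_, hv⟩
    exact h0.ne' ((hstat i hi).2.1.trans (hu.ep_eq i hi))
  · rw [PreGraph.sub_h hi]
    exact (hstat i hi).1.trans (hu.ph_eq i hi)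

/-- For `0 ≤ a ≤ c`, the upper subcrystal `K^up[a]` (colors `1, …, n-1`)
is an `A_{n-1}`-crystal with parameter `c^up_i = c_i - a_i + a_{i+1}`, and `v[a]` is its
principal vertex with coordinate `(a_2, …, a_n)`; symmetrically for the lower subcrystal
`K^low[b]` (colors `2, …, n`) with parameter `c^low_i = c_i - b_i + b_{i-1}` and heart
coordinate `h_i = b_{i-1}`. -/
theorem upper_lower_subcrystal_parameters
    (n : ℕ) (K : PreGraph) (hK : IsACrystal n K)
    (s : K.V) (hs : IsSource K s)
    (c : ℕ → ℕ) (hc : ∀ i, 1 ≤ i → i ≤ n → K.h i s = c i)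
    (a : ℕ → ℕ) (ha : ∀ i, 1 ≤ i → i ≤ n → a i ≤ c i)
    (pa : K.V) (hpa : IsPrin K 0 n s a pa)
    (b : ℕ → ℕ) (hb : ∀ i, 1 ≤ i → i ≤ n → b i ≤ c i)
    (pb : K.V) (hpb : IsPrin K 0 n s b pb) :
    (IsCrystalOn (K.sub (Set.Icc 1 (n - 1)) pa) (Set.Icc 1 (n - 1)) ∧
      ∃ s' : (K.sub (Set.Icc 1 (n - 1)) pa).V, IsSource (K.sub (Set.Icc 1 (n - 1)) pa) s' ∧
        (∀ i, 1 ≤ i → i ≤ n - 1 →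
          (K.sub (Set.Icc 1 (n - 1)) pa).h i s' + a i = c i + a (i + 1)) ∧
        IsPrin (K.sub (Set.Icc 1 (n - 1)) pa) 0 (n - 1) s' (fun i => a (i + 1))
          ⟨pa, Relation.ReflTransGen.refl⟩) ∧
    (IsCrystalOn (K.sub (Set.Icc 2 n) pb) (Set.Icc 2 n) ∧
      ∃ s'' : (K.sub (Set.Icc 2 n) pb).V, IsSource (K.sub (Set.Icc 2 n) pb) s'' ∧
        (∀ i, 2 ≤ i → i ≤ n →
          (K.sub (Set.Icc 2 n) pb).h i s'' + b i = c i + b (i - 1)) ∧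
        IsPrin (K.sub (Set.Icc 2 n) pb) 1 (n - 1) s'' (fun i => b (i - 1))
          ⟨pb, Relation.ReflTransGen.refl⟩) := by
  have hup : Set.Icc 1 (n - 1) ⊆ Set.Icc 1 n := Set.Icc_subset_Icc le_rfl (Nat.sub_le _ _)
  have hlow : Set.Icc 2 n ⊆ Set.Icc 1 n := Set.Icc_subset_Icc one_le_two le_rfl
  refine ⟨⟨PreGraph.sub_isCrystalOn hK hup, ?_⟩, PreGraph.sub_isCrystalOn hK hlow, ?_⟩
  · obtain ⟨X, x, y, u, -, hX, hx, hu, -⟩ :=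
      ECrystal.exists_principal_model n a fun i => c i - a i
    obtain ⟨s', hs', hh, hp⟩ := IsCrystalOn.exists_sub_source hK hup hs hX hx hu
      (fun i hi => by rw [hc i hi.1 hi.2, Nat.add_sub_cancel' (ha i hi.1 hi.2)]) hpa
    refine ⟨s', hs', fun i h1 h2 => ?_, hp⟩
    have := ha i h1 (by omega)
    rw [hh i ⟨h1, h2⟩]
    omega
  · obtain ⟨X, x, y, -, l, hX, hx, -, hl⟩ :=
      ECrystal.exists_principal_model n b fun i => c i - b i
    obtain ⟨s', hs', hh, hp⟩ := IsCrystalOn.exists_sub_source hK hlow hs hX hx hl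
      (fun i hi => by rw [hc i hi.1 hi.2, Nat.add_sub_cancel' (hb i hi.1 hi.2)]) hpb
    refine ⟨s', hs', fun i h1 h2 => ?_, hp⟩
    have := hb i (by omega) h2
    rw [hh i ⟨h1, h2⟩]
    omega
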